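/- There exists a bounded linear operator L₂ : H²(ℝ²)×H¹(ℝ²) → H^{5/2}(ℝ³) such that (i) [L₂(φ,ψ)](x₁,x₂,0) = φ(x₁,x₂), (ii) [∂L₂(φ,ψ)/∂x₃](x₁,x₂,0) = ψ(x₁,x₂), and (iii) L₂(φ,ψ)(x₁,x₂,x₃) vanishes on the half space x₁ < 0 (respectively, x₂ < 0) whenever φ(x₁,x₂) and ψ(x₁,x₂) vanish on the half plane x₁ < 0 (respectively, x₂ < 0). -/

import Mathlib

open MeasureTheory Real Set
open scoped RealInnerProductSpace
noncomputable section

abbrev E2 := EuclideanSpace ℝ (Fin 2)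
def stdb2 (i : Fin 2) : E2 := EuclideanSpace.single i 1
def L2on {n : ℕ} (Ω : Set (EuclideanSpace ℝ (Fin n))) (u : EuclideanSpace ℝ (Fin n) → ℝ) : Prop :=
  MemLp u 2 (volume.restrict Ω)
def IsWeakD {n : ℕ} (Ω : Set (EuclideanSpace ℝ (Fin n)))
    (u v : EuclideanSpace ℝ (Fin n) → ℝ) (d : EuclideanSpace ℝ (Fin n)) : Prop :=
  ∀ φ : EuclideanSpace ℝ (Fin n) → ℝ, ContDiff ℝ (⊤ : ℕ∞) φ → HasCompactSupport φ → tsupport φ ⊆ Ω →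
    ∫ x in Ω, u x * fderiv ℝ φ x d = - ∫ x in Ω, v x * φ x
def tri (p : Fin 3 → E2) : Set E2 := interior (convexHull ℝ (range p))
def evec (p : Fin 3 → E2) (i : Fin 3) : E2 := p (i + 2) - p (i + 1)
def elen (p : Fin 3 → E2) (i : Fin 3) : ℝ := ‖evec p i‖
def tangv (p : Fin 3 → E2) (i : Fin 3) : E2 := (elen p i)⁻¹ • evec p i
def norv (p : Fin 3 → E2) (i : Fin 3) : E2 :=
  EuclideanSpace.single 0 (tangv p i 1) + EuclideanSpace.single 1 (-(tangv p i 0))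
def epar (p : Fin 3 → E2) (i : Fin 3) (t : ℝ) : E2 := p (i + 1) + t • evec p i
def ccw (p : Fin 3 → E2) : Prop :=
  0 < (p 1 - p 0) 0 * (p 2 - p 0) 1 - (p 1 - p 0) 1 * (p 2 - p 0) 0
def tau (i j : Fin 3) : ℝ := if i = j + 1 then 0 else 1

/-- weak derivative on an open interval of `ℝ` -/
def IsWeakD1 (S : Set ℝ) (u v : ℝ → ℝ) : Prop :=
  ∀ φ : ℝ → ℝ, ContDiff ℝ (⊤ : ℕ∞) φ → HasCompactSupport φ → tsupport φ ⊆ S →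
    ∫ t in S, u t * deriv φ t = - ∫ t in S, v t * φ t

def MemHedge : ℕ → (ℝ → ℝ) → Prop
  | 0, u => MemLp u 2 (volume.restrict (Ioo (0:ℝ) 1))
  | (k+1), u => MemLp u 2 (volume.restrict (Ioo (0:ℝ) 1)) ∧
      ∃ v, IsWeakD1 (Ioo (0:ℝ) 1) u v ∧ MemHedge k v

/-- membership of edgewise data in `H²(∂T) × H¹(∂T)` (with pointwise C¹/C⁰ representatives) -/
def MemBdryH2H1 (f g : Fin 3 → ℝ → ℝ) : Prop :=
  ∀ i, MemHedge 2 (f i) ∧ ContDiffOn ℝ 1 (f i) (Icc 0 1) ∧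
    MemHedge 1 (g i) ∧ ContinuousOn (g i) (Icc 0 1)

/-- compatibility conditions (2.2)-(2.4) -/
def Compat (p : Fin 3 → E2) (f g : Fin 3 → ℝ → ℝ) : Prop :=
  (∀ i j k : Fin 3, j ≠ i → k ≠ i → f j (tau i j) = f k (tau i k)) ∧
  ∃ w : Fin 3 → E2, ∀ i j : Fin 3, j ≠ i →
    derivWithin (f j) (Icc 0 1) (tau i j) = elen p j * ⟪w i, tangv p j⟫ ∧
    g j (tau i j) = ⟪w i, norv p j⟫

/-- `H²` membership with explicit weak gradient and Hessian data -/
def MemH2W {n : ℕ} (Ω : Set (EuclideanSpace ℝ (Fin n))) (ξ : EuclideanSpace ℝ (Fin n) → ℝ)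
    (G : Fin n → EuclideanSpace ℝ (Fin n) → ℝ)
    (Hs : Fin n → Fin n → EuclideanSpace ℝ (Fin n) → ℝ) : Prop :=
  L2on Ω ξ ∧ (∀ d, L2on Ω (G d) ∧ IsWeakD Ω ξ (G d) (EuclideanSpace.single d 1)) ∧
  ∀ d d', L2on Ω (Hs d d') ∧ IsWeakD Ω (G d) (Hs d d') (EuclideanSpace.single d' 1)

/-- Gagliardo-type `H^{1/2}` seminorm finiteness for functions on a domain in `ℝⁿ` -/
def GagH12 {n : ℕ} (Ω : Set (EuclideanSpace ℝ (Fin n))) (u : EuclideanSpace ℝ (Fin n) → ℝ) : Prop :=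
  Integrable (fun q : EuclideanSpace ℝ (Fin n) × EuclideanSpace ℝ (Fin n) =>
    (u q.1 - u q.2) ^ 2 / ‖q.1 - q.2‖ ^ (n + 1)) ((volume.restrict Ω).prod (volume.restrict Ω))

/-- membership in `H^{5/2}` of a domain: weak `H²` data whose second derivatives have finite
`H^{1/2}` Gagliardo seminorm. -/
def MemH52 {n : ℕ} (Ω : Set (EuclideanSpace ℝ (Fin n))) (ζ : EuclideanSpace ℝ (Fin n) → ℝ) : Prop :=
  ∃ G Hs, MemH2W Ω ζ G Hs ∧ ∀ d d', GagH12 Ω (Hs d d')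

/-- pointwise trace relation `Tr ζ = (f,g)` on `∂T` for a `C¹` function -/
def TraceEq (p : Fin 3 → E2) (ζ : E2 → ℝ) (f g : Fin 3 → ℝ → ℝ) : Prop :=
  ∀ i : Fin 3, ∀ t ∈ Icc (0:ℝ) 1,
    ζ (epar p i t) = f i t ∧ fderiv ℝ ζ (epar p i t) (norv p i) = g i t

/-- membership in `H²(ℝ)` with explicit weak first and second derivatives -/
def MemH2line (φ φ₁ φ₂ : ℝ → ℝ) : Prop :=
  MemLp φ 2 (volume : Measure ℝ) ∧ MemLp φ₁ 2 (volume : Measure ℝ) ∧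
    MemLp φ₂ 2 (volume : Measure ℝ) ∧
    IsWeakD1 univ φ φ₁ ∧ IsWeakD1 univ φ₁ φ₂

/-- membership in `H¹(ℝ)` with explicit weak derivative -/
def MemH1line (ψ ψ₁ : ℝ → ℝ) : Prop :=
  MemLp ψ 2 (volume : Measure ℝ) ∧ MemLp ψ₁ 2 (volume : Measure ℝ) ∧ IsWeakD1 univ ψ ψ₁

/-- the squared Gagliardo `H^{1/2}` seminorm of `u` on `Ω ⊆ ℝⁿ` -/
def GagSqVal {n : ℕ} (Ω : Set (EuclideanSpace ℝ (Fin n))) (u : EuclideanSpace ℝ (Fin n) → ℝ) : ℝ :=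
  ∫ q, (u q.1 - u q.2) ^ 2 / ‖q.1 - q.2‖ ^ (n + 1)
    ∂((volume.restrict Ω).prod (volume.restrict Ω))
abbrev E3 := EuclideanSpace ℝ (Fin 3)
def stdb3 (i : Fin 3) : E3 := EuclideanSpace.single i 1

/-- the embedding of `ℝ²` onto the plane `x₃ = 0` in `ℝ³` -/
def embPlane (y : E2) : E3 := (y 0) • stdb3 0 + (y 1) • stdb3 1

/-- `b` is the trace of `u` on the plane `x₃ = 0` (computed from the upper half space),
in the sense of the divergence theorem; `Du` is the weak gradient of `u`. -/
def HalfTrace3 (u : E3 → ℝ) (Du : Fin 3 → E3 → ℝ) (b : E2 → ℝ) : Prop :=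
  ∀ φ : E3 → ℝ, ContDiff ℝ (⊤ : ℕ∞) φ → HasCompactSupport φ → ∀ d : Fin 3,
    ∫ x in {x : E3 | 0 < x 2}, (u x * fderiv ℝ φ x (stdb3 d) + Du d x * φ x)
      = -(if d = 2 then ∫ y : E2, b y * φ (embPlane y) else 0)


open scoped FourierTransform SchwartzMap ENNReal ContDiff

/-- The `L²` Fourier transform as an honest function (zero outside of `L²`). -/
def FH (f : E2 → ℂ) : E2 → ℂ :=
  open Classical in
  if h : MemLp f 2 (volume : Measure E2) then ⇑(𝓕 (h.toLp f) : Lp (α := E2) ℂ 2 volume) else 0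

lemma FH_of {f : E2 → ℂ} (h : MemLp f 2 (volume : Measure E2)) :
    FH f = ⇑(𝓕 (h.toLp f) : Lp (α := E2) ℂ 2 volume) := by
  unfold FH; rw [dif_pos h]

lemma FH_meas (f : E2 → ℂ) : StronglyMeasurable (FH f) := by
  by_cases h : MemLp f 2 (volume : Measure E2)
  · rw [FH_of h]; exact Lp.stronglyMeasurable _
  · unfold FH; rw [dif_neg h]; exact stronglyMeasurable_zero

lemma FH_memLp (f : E2 → ℂ) : MemLp (FH f) 2 (volume : Measure E2) := by
  by_cases h : MemLp f 2 (volume : Measure E2)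
  · rw [FH_of h]; exact Lp.memLp _
  · unfold FH; rw [dif_neg h]; exact MemLp.zero

lemma lint_sq_eq {α : Type*} [MeasurableSpace α] {μ : Measure α} (f : α → ℂ) :
    ∫⁻ x, ‖f x‖ₑ ^ 2 ∂μ = eLpNorm f 2 μ ^ 2 := by
  rw [eLpNorm_eq_lintegral_rpow_enorm_toReal (by norm_num) (by norm_num)]
  rw [← ENNReal.rpow_natCast, ← ENNReal.rpow_mul]
  simp

lemma FH_lint {f : E2 → ℂ} (h : MemLp f 2 (volume : Measure E2)) :
    ∫⁻ x, ‖FH f x‖ₑ ^ 2 = ∫⁻ x, ‖f x‖ₑ ^ 2 := by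
  rw [lint_sq_eq, lint_sq_eq, FH_of h, ← eLpNorm_congr_ae h.coeFn_toLp]
  have := Lp.norm_fourier_eq (h.toLp f)
  rw [Lp.norm_def, Lp.norm_def] at this
  rw [(ENNReal.toReal_eq_toReal_iff' (Lp.eLpNorm_ne_top _) (Lp.eLpNorm_ne_top _)).1 this]

lemma FH_pair {f : E2 → ℂ} (h : MemLp f 2 (volume : Measure E2)) (g : 𝓢(E2, ℂ)) :
    ∫ x, g x * FH f x = ∫ x, (𝓕 g) x * f x := by
  have h1 := congrArg (fun D : 𝓢'(E2, ℂ) => D g) (Lp.fourier_toTemperedDistribution_eq (h.toLp f))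
  simp only [Lp.toTemperedDistribution_apply, TemperedDistribution.fourier_apply] at h1
  rw [FH_of h]
  simp only [smul_eq_mul] at h1
  rw [← h1]
  apply integral_congr_ae
  filter_upwards [h.coeFn_toLp] with x hx
  rw [hx]

lemma FH_lin {f g : E2 → ℂ} (hf : MemLp f 2 (volume : Measure E2))
    (hg : MemLp g 2 (volume : Measure E2)) (a : ℂ) :
    FH (fun x => a * f x + g x) =ᵐ[volume] fun x => a * FH f x + FH g x := by
  have h : MemLp (fun x => a * f x + g x) 2 (volume : Measure E2) := (hf.const_mul a).add hg
  rw [FH_of hf, FH_of hg, FH_of h]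
  have e : h.toLp (fun x => a * f x + g x) = a • hf.toLp f + hg.toLp g := by
    rw [← MemLp.toLp_const_smul, ← MemLp.toLp_add]; rfl
  rw [e, FourierTransform.fourier_add, FourierTransform.fourier_smul]
  filter_upwards [Lp.coeFn_add (a • 𝓕 (hf.toLp f)) (𝓕 (hg.toLp g)),
    Lp.coeFn_smul a (𝓕 (hf.toLp f))] with x h1 h2
  rw [h1, Pi.add_apply, h2]; rfl

lemma inv_pair {b g : E2 → ℂ} (hb : Integrable b) (hg : Integrable g) :
    ∫ x, 𝓕⁻ b x * g x = ∫ x, b x * 𝓕⁻ g x := by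
  have := VectorFourier.integral_fourierIntegral_smul_eq_flip (μ := (volume : Measure E2))
    (ν := (volume : Measure E2)) (L := -(innerₗ E2)) (e := Real.fourierChar)
    (f := b) (g := g) Real.continuous_fourierChar (by
      simp only [LinearMap.neg_apply, innerₗ_apply_apply]
      fun_prop) hb hg
  have e : (-(innerₗ E2)).flip = -(innerₗ E2) := by
    ext x y; simp [real_inner_comm]
  rw [e] at this
  exact this

lemma inv_continuous {b : E2 → ℂ} (hb : Integrable b) : Continuous (𝓕⁻ b) :=
  VectorFourier.fourierIntegral_continuous (μ := (volume : Measure E2))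
    (L := -(innerₗ E2)) (e := Real.fourierChar) Real.continuous_fourierChar (by
      simp only [LinearMap.neg_apply, innerₗ_apply_apply]
      fun_prop) hb

lemma inv_ae {b : E2 → ℂ} (hb : Integrable b) (h2 : MemLp b 2 (volume : Measure E2)) :
    𝓕⁻ b =ᵐ[volume] ⇑(𝓕⁻ (h2.toLp b) : Lp (α := E2) ℂ 2 volume) := by
  apply ae_eq_of_integral_contDiff_smul_eq
  · exact (inv_continuous hb).locallyIntegrable
  · exact (Lp.memLp _).locallyIntegrable (by norm_num)
  · intro g hg hc
    have hg₁ : HasCompactSupport (Complex.ofRealCLM ∘ g) := hc.comp_left rfl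
    have hg₂ : ContDiff ℝ ∞ (Complex.ofRealCLM ∘ g) := by fun_prop
    set G : 𝓢(E2, ℂ) := hg₁.toSchwartzMap hg₂ with hG
    have hGx : ∀ x, G x = (g x : ℂ) := fun x => rfl
    have h1 := congrArg (fun D : 𝓢'(E2, ℂ) => D G)
      (Lp.fourierInv_toTemperedDistribution_eq (h2.toLp b))
    simp only [Lp.toTemperedDistribution_apply, TemperedDistribution.fourierInv_apply] at h1
    have h3 : ∫ x, g x • (𝓕⁻ (h2.toLp b) : Lp (α := E2) ℂ 2 volume) x
      = ∫ x, G x • (𝓕⁻ (h2.toLp b) : Lp (α := E2) ℂ 2 volume) x := by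
      simp [hGx]
    rw [h3, ← h1]
    have h4 : ∫ x, g x • 𝓕⁻ b x = ∫ x, 𝓕⁻ b x * G x := by
      congr 1; ext x; rw [hGx, Complex.real_smul, mul_comm]
    rw [h4, inv_pair hb G.integrable]
    apply integral_congr_ae
    filter_upwards [h2.coeFn_toLp] with x hx
    rw [hx, smul_eq_mul, mul_comm, SchwartzMap.fourierInv_coe]

lemma planch {b : E2 → ℂ} (hb : Integrable b) (h2 : MemLp b 2 (volume : Measure E2)) :
    ∫⁻ x, ‖𝓕⁻ b x‖ₑ ^ 2 = ∫⁻ x, ‖b x‖ₑ ^ 2 := by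
  rw [lint_sq_eq, lint_sq_eq, eLpNorm_congr_ae (inv_ae hb h2), ← eLpNorm_congr_ae h2.coeFn_toLp]
  have := Lp.norm_fourier_eq (𝓕⁻ (h2.toLp b))
  rw [FourierTransform.fourier_fourierInv_eq, Lp.norm_def, Lp.norm_def] at this
  rw [(ENNReal.toReal_eq_toReal_iff' (Lp.eLpNorm_ne_top _) (Lp.eLpNorm_ne_top _)).1 this]

lemma FH_inv {f : E2 → ℂ} (h : MemLp f 2 (volume : Measure E2)) (hb : Integrable (FH f)) :
    𝓕⁻ (FH f) =ᵐ[volume] f := by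
  refine (inv_ae hb (FH_memLp f)).trans ?_
  have e : (FH_memLp f).toLp (FH f) = 𝓕 (h.toLp f) := by
    apply Lp.ext
    refine (MemLp.coeFn_toLp _).trans ?_
    rw [FH_of h]
  rw [e, FourierTransform.fourierInv_fourier_eq]
  exact h.coeFn_toLp


lemma weak_ext {f g : E2 → ℝ} (hf : MemLp f 2 (volume : Measure E2))
    (hg : MemLp g 2 (volume : Measure E2)) {d : E2} (hw : IsWeakD (univ : Set E2) f g d)
    {ζ : E2 → ℝ} (hζ : ContDiff ℝ ∞ ζ) (hζ2 : MemLp ζ 2 (volume : Measure E2))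
    (hζ' : MemLp (fun x => fderiv ℝ ζ x d) 2 (volume : Measure E2)) :
    ∫ x, f x * fderiv ℝ ζ x d = - ∫ x, g x * ζ x := by
  let χ : ContDiffBump (0 : E2) := ⟨1, 2, by norm_num, by norm_num⟩
  have hχs : ContDiff ℝ ∞ (χ : E2 → ℝ) := χ.contDiff
  have hχc : HasCompactSupport (χ : E2 → ℝ) := χ.hasCompactSupport
  obtain ⟨C, hC⟩ : ∃ C, ∀ x, ‖fderiv ℝ (χ : E2 → ℝ) x‖ ≤ C :=
    (hχc.fderiv (𝕜 := ℝ)).exists_bound_of_continuous (hχs.continuous_fderiv (by simp))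
  let r : ℕ → ℝ := fun n => ((n : ℝ) + 1)⁻¹
  have hr0 : ∀ n, r n ≠ 0 := fun n => by positivity
  have hr1 : ∀ n, |r n| ≤ 1 := fun n => by
    rw [abs_of_nonneg (by positivity)]
    exact inv_le_one_of_one_le₀ (by linarith [Nat.cast_nonneg (α := ℝ) n])
  have hrt : Filter.Tendsto r Filter.atTop (nhds 0) := by
    have := tendsto_one_div_add_atTop_nhds_zero_nat (𝕜 := ℝ)
    simpa [r, one_div] using this
  let ζn : ℕ → E2 → ℝ := fun n x => χ (r n • x) * ζ x
  have hd : ∀ n x, fderiv ℝ (ζn n) x d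
      = χ (r n • x) * fderiv ℝ ζ x d + ζ x * (r n * fderiv ℝ (χ : E2 → ℝ) (r n • x) d) := by
    intro n x
    have h1 : HasFDerivAt (fun x : E2 => χ (r n • x))
        ((fderiv ℝ (χ : E2 → ℝ) (r n • x)).comp (r n • ContinuousLinearMap.id ℝ E2)) x := by
      have ha : HasFDerivAt (χ : E2 → ℝ) (fderiv ℝ (χ : E2 → ℝ) (r n • x)) (r n • x) :=
        (hχs.differentiable (by simp) _).hasFDerivAt
      exact ha.comp x ((hasFDerivAt_id x).const_smul (r n))
    have h2 : HasFDerivAt ζ (fderiv ℝ ζ x) x := (hζ.differentiable (by simp) x).hasFDerivAt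
    have h3 : HasFDerivAt (ζn n) _ x := h1.mul h2
    rw [h3.fderiv]
    simp
  have hw' : ∀ n, ∫ x, f x * fderiv ℝ (ζn n) x d = - ∫ x, g x * ζn n x := by
    intro n
    have hs : ContDiff ℝ ∞ (ζn n) := (hχs.comp (contDiff_const_smul (r n))).mul hζ
    have hc : HasCompactSupport (ζn n) :=
      HasCompactSupport.mul_right (hχc.comp_homeomorph (Homeomorph.smulOfNeZero (r n) (hr0 n)))
    have := hw (ζn n) hs hc (subset_univ _)
    simpa using this
  have hχt : ∀ x : E2, Filter.Tendsto (fun n => χ (r n • x)) Filter.atTop (nhds 1) := by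
    intro x
    have h0 : χ (0 : E2) = 1 := χ.one_of_mem_closedBall (by simp [χ])
    have h1 : Filter.Tendsto (fun n => r n • x) Filter.atTop (nhds (0 : E2)) := by
      simpa using hrt.smul_const x
    have := (hχs.continuous.tendsto 0).comp h1
    rwa [h0] at this
  have hχb : ∀ x : E2, |χ x| ≤ 1 := fun x => by
    rw [abs_of_nonneg χ.nonneg]; exact χ.le_one
  have hbd : ∀ n x, |r n * fderiv ℝ (χ : E2 → ℝ) (r n • x) d| ≤ r n * (C * ‖d‖) := fun n x => by
    rw [abs_mul, abs_of_nonneg (a := r n) (by positivity)]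
    gcongr
    exact ((fderiv ℝ (χ : E2 → ℝ) (r n • x)).le_opNorm d).trans (by gcongr; exact hC _)
  have hC0 : 0 ≤ C := (norm_nonneg _).trans (hC 0)
  have i1 : Integrable (fun x => f x * fderiv ℝ ζ x d) := hf.integrable_mul hζ'
  have i2 : Integrable (fun x => f x * ζ x) := hf.integrable_mul hζ2
  have i3 : Integrable (fun x => g x * ζ x) := hg.integrable_mul hζ2
  have L1 : Filter.Tendsto (fun n => ∫ x, f x * fderiv ℝ (ζn n) x d) Filter.atTop
      (nhds (∫ x, f x * fderiv ℝ ζ x d)) := by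
    apply tendsto_integral_of_dominated_convergence
      (fun x => |f x * fderiv ℝ ζ x d| + |f x * ζ x| * (C * ‖d‖))
    · intro n
      refine hf.1.mul ?_
      have hs : ContDiff ℝ ∞ (ζn n) := (hχs.comp (contDiff_const_smul (r n))).mul hζ
      have := hs.continuous_fderiv (by simp)
      exact (this.clm_apply continuous_const).aestronglyMeasurable
    · exact i1.abs.add (i2.abs.mul_const _)
    · intro n
      filter_upwards with x
      rw [hd, mul_add, Real.norm_eq_abs]
      refine (abs_add_le _ _).trans (add_le_add ?_ ?_)
      · rw [abs_mul, abs_mul, abs_mul]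
        have := hχb (r n • x)
        gcongr
        nlinarith [abs_nonneg (fderiv ℝ ζ x d)]
      · rw [← mul_assoc, abs_mul]
        gcongr
        refine (hbd n x).trans ?_
        have := (le_abs_self _).trans (hr1 n)
        nlinarith [mul_nonneg hC0 (norm_nonneg d)]
    · filter_upwards with x
      simp_rw [hd]
      refine Filter.Tendsto.const_mul _ ?_
      have ha := (hχt x).mul_const (fderiv ℝ ζ x d)
      have hb : Filter.Tendsto (fun n => r n * fderiv ℝ (χ : E2 → ℝ) (r n • x) d)
          Filter.atTop (nhds 0) := by
        apply squeeze_zero_norm (fun n => hbd n x)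
        simpa using hrt.mul_const (C * ‖d‖)
      simpa using ha.add (hb.const_mul (ζ x))
  have L2 : Filter.Tendsto (fun n => - ∫ x, g x * ζn n x) Filter.atTop
      (nhds (- ∫ x, g x * ζ x)) := by
    refine Filter.Tendsto.neg ?_
    apply tendsto_integral_of_dominated_convergence (fun x => |g x * ζ x|)
    · intro n
      refine hg.1.mul ?_
      have hs : ContDiff ℝ ∞ (ζn n) := (hχs.comp (contDiff_const_smul (r n))).mul hζ
      exact hs.continuous.aestronglyMeasurable
    · exact i3.abs
    · intro n
      filter_upwards with x
      rw [Real.norm_eq_abs, abs_mul, abs_mul, abs_mul]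
      have := hχb (r n • x)
      gcongr
      nlinarith [abs_nonneg (ζ x)]
    · filter_upwards with x
      refine Filter.Tendsto.const_mul _ ?_
      simpa using (hχt x).mul_const (ζ x)
  refine tendsto_nhds_unique L1 ?_
  simp_rw [hw']
  exact L2

lemma memLp_ofReal {α : Type*} [MeasurableSpace α] {μ : Measure α} {f : α → ℝ}
    (hf : MemLp f 2 μ) : MemLp (fun x => (f x : ℂ)) 2 μ := hf.ofReal

lemma weak_schwartz {f g : E2 → ℝ} (hf : MemLp f 2 (volume : Measure E2))
    (hg : MemLp g 2 (volume : Measure E2)) {d : E2} (hw : IsWeakD (univ : Set E2) f g d)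
    (η : 𝓢(E2, ℂ)) :
    ∫ x, (LineDeriv.lineDerivOp d η : 𝓢(E2, ℂ)) x * (f x : ℂ) = - ∫ x, η x * (g x : ℂ) := by
  set η' : 𝓢(E2, ℂ) := LineDeriv.lineDerivOp d η with hη'
  have hder : ∀ x, η' x = fderiv ℝ η x d := fun x => SchwartzMap.lineDerivOp_apply_eq_fderiv d η x
  have hη2 : MemLp η 2 (volume : Measure E2) := η.memLp 2
  have hη'2 : MemLp η' 2 (volume : Measure E2) := η'.memLp 2
  have hdiff : ∀ x, HasFDerivAt η (fderiv ℝ η x) x := fun x =>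
    (η.differentiable x).hasFDerivAt
  have hre : ∀ x, fderiv ℝ (fun x => (η x).re) x d = (η' x).re := by
    intro x
    have := (Complex.reCLM.hasFDerivAt (x := η x)).comp x (hdiff x)
    have h2 : HasFDerivAt (fun x => (η x).re) (Complex.reCLM.comp (fderiv ℝ η x)) x := this
    rw [h2.fderiv, hder]; rfl
  have him : ∀ x, fderiv ℝ (fun x => (η x).im) x d = (η' x).im := by
    intro x
    have := (Complex.imCLM.hasFDerivAt (x := η x)).comp x (hdiff x)
    have h2 : HasFDerivAt (fun x => (η x).im) (Complex.imCLM.comp (fderiv ℝ η x)) x := this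
    rw [h2.fderiv, hder]; rfl
  have e1 := weak_ext hf hg hw (ζ := fun x => (η x).re)
    (Complex.reCLM.contDiff.comp (η.smooth ⊤)) hη2.re (by simp_rw [hre]; exact hη'2.re)
  have e2 := weak_ext hf hg hw (ζ := fun x => (η x).im)
    (Complex.imCLM.contDiff.comp (η.smooth ⊤)) hη2.im (by simp_rw [him]; exact hη'2.im)
  simp_rw [hre] at e1
  simp_rw [him] at e2
  have i1 : Integrable (fun x => η' x * (f x : ℂ)) := hη'2.integrable_mul (memLp_ofReal hf)
  have i2 : Integrable (fun x => η x * (g x : ℂ)) := hη2.integrable_mul (memLp_ofReal hg)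
  have r1 : ∀ F : E2 → ℂ, Integrable F → (∫ x, F x).re = ∫ x, (F x).re := fun F hF =>
    (Complex.reCLM.integral_comp_comm hF).symm
  have r2 : ∀ F : E2 → ℂ, Integrable F → (∫ x, F x).im = ∫ x, (F x).im := fun F hF =>
    (Complex.imCLM.integral_comp_comm hF).symm
  apply Complex.ext
  · rw [Complex.neg_re, r1 _ i1, r1 _ i2]
    simp only [Complex.mul_re, Complex.ofReal_re, Complex.ofReal_im, mul_zero, sub_zero]
    simp_rw [mul_comm (η' _).re, mul_comm (η _).re]
    exact e1
  · rw [Complex.neg_im, r2 _ i1, r2 _ i2]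
    simp only [Complex.mul_im, Complex.ofReal_re, Complex.ofReal_im, mul_zero, zero_add]
    simp_rw [mul_comm (η' _).im, mul_comm (η _).im]
    exact e2

lemma FH_weak {f g : E2 → ℝ} (hf : MemLp f 2 (volume : Measure E2))
    (hg : MemLp g 2 (volume : Measure E2)) {d : Fin 2}
    (hw : IsWeakD (univ : Set E2) f g (EuclideanSpace.single d 1)) :
    FH (fun x => (g x : ℂ)) =ᵐ[volume]
      fun ξ => (2 * π * Complex.I * (ξ d : ℂ)) * FH (fun x => (f x : ℂ)) ξ := by
  have hL : LocallyIntegrable (FH (fun x => (f x : ℂ))) :=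
    (FH_memLp _).locallyIntegrable (by norm_num)
  apply ae_eq_of_integral_contDiff_smul_eq
  · exact (FH_memLp _).locallyIntegrable (by norm_num)
  · have hc : Continuous (fun ξ : E2 => (2 * π * Complex.I * (ξ d : ℂ))) := by fun_prop
    rw [← locallyIntegrableOn_univ] at hL ⊢
    exact hL.continuousOn_mul hc.continuousOn isOpen_univ.isLocallyClosed
  · intro h hh hc
    have hg₁ : HasCompactSupport (Complex.ofRealCLM ∘ h) := hc.comp_left rfl
    have hg₂ : ContDiff ℝ ∞ (Complex.ofRealCLM ∘ h) := by fun_prop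
    set G : 𝓢(E2, ℂ) := hg₁.toSchwartzMap hg₂ with hG
    have hGx : ∀ x, G x = (h x : ℂ) := fun x => rfl
    have p1 := FH_pair (memLp_ofReal hg) G
    have p2 := weak_schwartz hf hg hw (𝓕 G)
    rw [SchwartzMap.lineDerivOp_fourier_eq] at p2
    have p3 := FH_pair (memLp_ofReal hf) (-(2 * ↑π * Complex.I) •
      (SchwartzMap.smulLeftCLM ℂ fun x => ⟪x, (EuclideanSpace.single d 1 : E2)⟫) G)
    rw [p2, ← p1] at p3
    have e1 : ∫ x, h x • FH (fun x => (g x : ℂ)) x = ∫ x, G x * FH (fun x => (g x : ℂ)) x := by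
      simp [hGx]
    rw [e1, ← neg_inj, ← p3, ← integral_neg]
    congr 1; ext x
    have : (fun x => ⟪x, (EuclideanSpace.single d 1 : E2)⟫).HasTemperateGrowth := by fun_prop
    rw [smul_apply, SchwartzMap.smulLeftCLM_apply_apply this, hGx]
    simp [EuclideanSpace.inner_single_right]
    ring


/-- splitting of `ℝ³` as vertical coordinate and horizontal coordinates -/
def e3 : E3 ≃ᵐ ℝ × E2 :=
  ((MeasurableEquiv.toLp 2 (Fin 3 → ℝ)).symm.trans
    (MeasurableEquiv.piFinSuccAbove (fun _ => ℝ) 2)).trans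
    ((MeasurableEquiv.refl ℝ).prodCongr (MeasurableEquiv.toLp 2 (Fin 2 → ℝ)))

lemma e3_mp : MeasurePreserving e3 (volume : Measure E3) (volume : Measure (ℝ × E2)) := by
  have h1 := EuclideanSpace.volume_preserving_symm_measurableEquiv_toLp (Fin 3)
  have h2 := volume_preserving_piFinSuccAbove (fun _ : Fin 3 => ℝ) 2
  have h3 : MeasurePreserving (Prod.map (id : ℝ → ℝ) (MeasurableEquiv.toLp 2 (Fin 2 → ℝ)))
      (volume.prod volume) (volume.prod volume) :=
    (MeasurePreserving.id volume).prod (PiLp.volume_preserving_toLp (Fin 2))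
  exact h3.comp (h2.comp h1)

/-- horizontal part -/
def pr (x : E3) : E2 := !₂[x 0, x 1]

lemma e3_apply (x : E3) : e3 x = (x 2, pr x) := by
  refine Prod.ext rfl ?_
  ext i
  fin_cases i <;> rfl

/-- inverse splitting -/
def jn (z : ℝ) (y : E2) : E3 := !₂[y 0, y 1, z]

lemma e3_jn (z : ℝ) (y : E2) : e3 (jn z y) = (z, y) := by
  rw [e3_apply]
  refine Prod.ext rfl ?_
  ext i
  fin_cases i <;> rfl

lemma e3_symm (p : ℝ × E2) : e3.symm p = jn p.1 p.2 := by
  rw [MeasurableEquiv.symm_apply_eq, e3_jn]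

lemma jn_embPlane (y : E2) : jn 0 y = embPlane y := by
  ext i
  fin_cases i <;> simp [jn, embPlane, stdb3]

lemma pr_cont : Continuous pr := by
  unfold pr; fun_prop

lemma pr_add (x y : E3) : pr (x + y) = pr x + pr y := by
  ext i; fin_cases i <;> simp [pr]

lemma pr_norm (x : E3) : ‖pr x‖ ≤ ‖x‖ := by
  rw [EuclideanSpace.norm_eq, EuclideanSpace.norm_eq]
  apply Real.sqrt_le_sqrt
  simp [Fin.sum_univ_succ, pr]
  nlinarith [sq_nonneg (x 2)]

lemma x2_norm (x : E3) : |x 2| ≤ ‖x‖ := by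
  simpa using PiLp.norm_apply_le x 2

lemma lint_e3 {f : ℝ × E2 → ℝ≥0∞} (hf : Measurable f) :
    ∫⁻ x : E3, f (x 2, pr x) = ∫⁻ z, ∫⁻ y, f (z, y) := by
  have := e3_mp.lintegral_comp hf
  simp_rw [e3_apply] at this
  rw [this, Measure.volume_eq_prod, lintegral_prod _ hf.aemeasurable]

/-- the symbols `1 + 2πiξ_j` -/
def sj (j : Fin 2) (ξ : E2) : ℂ := 1 + 2 * π * Complex.I * (ξ j : ℂ)
def sig (ξ : E2) : ℝ := ‖sj 0 ξ‖ + ‖sj 1 ξ‖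

lemma sj_re (j : Fin 2) (ξ : E2) : (sj j ξ).re = 1 := by simp [sj]
lemma sj_im (j : Fin 2) (ξ : E2) : (sj j ξ).im = 2 * π * ξ j := by simp [sj]
lemma sj_cont (j : Fin 2) : Continuous (sj j) := by unfold sj; fun_prop
lemma sig_cont : Continuous sig := by
  unfold sig; exact (sj_cont 0).norm.add (sj_cont 1).norm

lemma sj_norm (j : Fin 2) (ξ : E2) : 1/2 + |ξ j| ≤ ‖sj j ξ‖ := by
  rw [Complex.norm_eq_sqrt_sq_add_sq, sj_re, sj_im]
  apply Real.le_sqrt_of_sq_le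
  have h : (2 * π * ξ j)^2 = 4 * π^2 * |ξ j|^2 := by rw [sq_abs]; ring
  rw [h]
  have := Real.pi_gt_three
  have h2 : 1 ≤ π^2 := by nlinarith
  nlinarith [sq_nonneg (|ξ j| - 1/2), mul_le_mul_of_nonneg_right h2 (sq_nonneg |ξ j|),
    abs_nonneg (ξ j)]

lemma sj_norm_one (j : Fin 2) (ξ : E2) : 1 ≤ ‖sj j ξ‖ := by
  have := Complex.abs_re_le_norm (sj j ξ)
  rwa [sj_re, abs_one] at this

lemma sj_le (j : Fin 2) (ξ : E2) : ‖sj j ξ‖ ≤ sig ξ := by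
  unfold sig; fin_cases j <;> simp

lemma xi_le (j : Fin 2) (ξ : E2) : ‖(2 * π * Complex.I * (ξ j : ℂ))‖ ≤ sig ξ := by
  refine le_trans ?_ (sj_le j ξ)
  have := Complex.abs_im_le_norm (sj j ξ)
  rw [sj_im] at this
  simpa [abs_mul, abs_of_pos Real.pi_pos] using this

lemma sig_one (ξ : E2) : 1 ≤ sig ξ := (sj_norm_one 0 ξ).trans (sj_le 0 ξ)
lemma sig_pos (ξ : E2) : 0 < sig ξ := lt_of_lt_of_le one_pos (sig_one ξ)

lemma sig_norm (ξ : E2) : 1 + ‖ξ‖ ≤ sig ξ := by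
  have h0 := sj_norm 0 ξ
  have h1 := sj_norm 1 ξ
  have : ‖ξ‖ ≤ |ξ 0| + |ξ 1| := by
    rw [EuclideanSpace.norm_eq]
    apply Real.sqrt_le_iff.2 ⟨by positivity, ?_⟩
    simp [Fin.sum_univ_two]
    nlinarith [abs_nonneg (ξ 0), abs_nonneg (ξ 1), sq_abs (ξ 0), sq_abs (ξ 1),
      mul_nonneg (abs_nonneg (ξ 0)) (abs_nonneg (ξ 1))]
  unfold sig; linarith

lemma sig_upper (ξ : E2) : sig ξ ≤ 2 + 2*π*|ξ 0| + 2*π*|ξ 1| := by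
  have h : ∀ j, ‖sj j ξ‖ ≤ 1 + 2*π*|ξ j| := fun j => by
    unfold sj
    refine (norm_add_le _ _).trans ?_
    simp [abs_of_pos Real.pi_pos]
  unfold sig; linarith [h 0, h 1]

lemma sig_int : Integrable (fun ξ : E2 => (sig ξ)^(-4 : ℝ)) := by
  have h : Integrable (fun ξ : E2 => (1 + ‖ξ‖)^(-(4:ℝ))) :=
    integrable_one_add_norm (by simp; norm_num)
  refine h.mono' ?_ ?_
  · exact (sig_cont.rpow_const (fun x => Or.inl (sig_pos x).ne')).aestronglyMeasurable
  · filter_upwards with ξ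
    rw [Real.norm_of_nonneg (Real.rpow_nonneg (sig_pos ξ).le _)]
    exact Real.rpow_le_rpow_of_nonpos (by positivity) (sig_norm ξ) (by norm_num)

lemma sig_memLp : MemLp (fun ξ : E2 => ((sig ξ)^2)⁻¹) 2 (volume : Measure E2) := by
  have hm : AEStronglyMeasurable (fun ξ : E2 => ((sig ξ)^2)⁻¹) volume :=
    ((sig_cont.pow 2).inv₀ (fun x => pow_ne_zero _ (sig_pos x).ne')).aestronglyMeasurable
  rw [memLp_two_iff_integrable_sq hm]
  refine sig_int.congr ?_
  filter_upwards with ξ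
  rw [Real.rpow_neg (sig_pos ξ).le]
  norm_cast
  rw [inv_pow, ← pow_mul]

/-- synthesis operator -/
def TC (K : ℝ → E2 → ℂ) (x : E3) : ℂ := 𝓕⁻ (K (x 2)) (pr x)

lemma inv_meas {K : ℝ → E2 → ℂ} (hK : Measurable (Function.uncurry K)) :
    StronglyMeasurable (fun p : ℝ × E2 => 𝓕⁻ (K p.1) p.2) := by
  simp_rw [Real.fourierInv_eq']
  have : StronglyMeasurable (fun q : (ℝ × E2) × E2 =>
      Complex.exp (↑(2 * π * ⟪q.2, q.1.2⟫) * Complex.I) • K q.1.1 q.2) := by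
    apply Measurable.stronglyMeasurable
    refine Measurable.fun_smul ?_ ?_
    · fun_prop
    · exact hK.comp (f := fun q : (ℝ × E2) × E2 => (q.1.1, q.2)) (by fun_prop)
  exact this.integral_prod_right

lemma TC_meas {K : ℝ → E2 → ℂ} (hK : Measurable (Function.uncurry K)) :
    Measurable (TC K) := by
  have := (inv_meas hK).measurable.comp (f := fun x : E3 => (x 2, pr x))
    (by have := pr_cont; fun_prop)
  exact this

lemma TC_lint {K : ℝ → E2 → ℂ} (hK : Measurable (Function.uncurry K))
    (hs : ∀ᵐ z : ℝ, Integrable (K z) ∧ MemLp (K z) 2 (volume : Measure E2)) :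
    ∫⁻ x : E3, ‖TC K x‖ₑ ^ 2 = ∫⁻ ξ, ∫⁻ z, ‖K z ξ‖ₑ ^ 2 := by
  have hm : Measurable (fun p : ℝ × E2 => ‖𝓕⁻ (K p.1) p.2‖ₑ ^ 2) :=
    (inv_meas hK).measurable.enorm.pow_const 2
  have h1 := lint_e3 hm
  have h2 : ∫⁻ x : E3, ‖TC K x‖ₑ ^ 2 = ∫⁻ z, ∫⁻ ξ, ‖K z ξ‖ₑ ^ 2 := by
    refine h1.trans (lintegral_congr_ae ?_)
    filter_upwards [hs] with z hz
    exact planch hz.1 hz.2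
  rw [h2, lintegral_lintegral_swap]
  exact (hK.enorm.pow_const 2).aemeasurable


lemma lint_smul {E : Type*} [NormedAddCommGroup E] [NormedSpace ℝ E] [FiniteDimensional ℝ E]
    [MeasureSpace E] [BorelSpace E] [(volume : Measure E).IsAddHaarMeasure]
    {f : E → ℝ≥0∞} (hf : Measurable f) {r : ℝ} (hr : 0 < r) :
    ∫⁻ x, f (r • x) = ENNReal.ofReal (r ^ Module.finrank ℝ E)⁻¹ * ∫⁻ x, f x := by
  have h := Measure.map_addHaar_smul (volume : Measure E) hr.ne'
  have h2 : ∫⁻ x, f x ∂(Measure.map (r • ·) (volume : Measure E)) = ∫⁻ x, f (r • x) :=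
    lintegral_map hf (measurable_const_smul r)
  rw [← h2, h, lintegral_smul_measure, abs_of_pos (by positivity), smul_eq_mul]

/-- decay function -/
def dz (t : ℝ) : ℝ := ((1 + |t|)^2)⁻¹
def c0 : ℝ≥0∞ := ∫⁻ z : ℝ, ENNReal.ofReal (dz z)

lemma dz_cont : Continuous dz := by
  unfold dz
  refine Continuous.inv₀ (by fun_prop) (fun x => by positivity)

lemma dz_nonneg (t : ℝ) : 0 ≤ dz t := by unfold dz; positivity
lemma dz_le_one (t : ℝ) : dz t ≤ 1 := by
  unfold dz
  apply inv_le_one_of_one_le₀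
  nlinarith [abs_nonneg t]

lemma c0_lt : c0 < ⊤ := by
  have h : Integrable (fun z : ℝ => (1 + ‖z‖)^(-(2:ℝ))) :=
    integrable_one_add_norm (by simp)
  have h2 : Integrable dz := by
    refine h.congr ?_
    filter_upwards with z
    rw [Real.rpow_neg (by positivity)]
    norm_cast
  exact h2.lintegral_lt_top

lemma c0_scale {s : ℝ} (hs : 0 < s) :
    ∫⁻ z : ℝ, ENNReal.ofReal (dz (s * z)) = ENNReal.ofReal s⁻¹ * c0 := by
  have := lint_smul (f := fun z : ℝ => ENNReal.ofReal (dz z))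
    (ENNReal.measurable_ofReal.comp dz_cont.measurable) hs
  simpa [c0] using this

/-- order zero symbols with amplitude `A` -/
structure Sy (K : ℝ → E2 → ℂ) (A : E2 → ℝ) : Prop where
  meas : Measurable (Function.uncurry K)
  bd : ∀ z ξ, ‖K z ξ‖ ≤ A ξ * (dz (sig ξ * z))^2
  lip : ∀ z z' ξ, ‖K z ξ - K z' ξ‖ ≤ A ξ * sig ξ * |z - z'|

lemma Sy.A_nonneg {K : ℝ → E2 → ℂ} {A : E2 → ℝ} (h : Sy K A) (ξ : E2) : 0 ≤ A ξ := by
  have := (norm_nonneg _).trans (h.bd 0 ξ)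
  simpa [dz] using this

lemma Sy.bd' {K : ℝ → E2 → ℂ} {A : E2 → ℝ} (h : Sy K A) (z : ℝ) (ξ : E2) :
    ‖K z ξ‖ ≤ A ξ * dz (sig ξ * z) := by
  refine (h.bd z ξ).trans ?_
  have := h.A_nonneg ξ
  gcongr
  nlinarith [dz_nonneg (sig ξ * z), dz_le_one (sig ξ * z)]

lemma Sy.bd1 {K : ℝ → E2 → ℂ} {A : E2 → ℝ} (h : Sy K A) (z : ℝ) (ξ : E2) :
    ‖K z ξ‖ ≤ A ξ := by
  refine (h.bd' z ξ).trans ?_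
  have := h.A_nonneg ξ
  nlinarith [dz_nonneg (sig ξ * z), dz_le_one (sig ξ * z)]

lemma Sy.memLp {K : ℝ → E2 → ℂ} {A : E2 → ℝ} (h : Sy K A)
    (hA : MemLp A 2 (volume : Measure E2)) (z : ℝ) : MemLp (K z) 2 (volume : Measure E2) := by
  refine hA.mono ?_ ?_
  · exact (h.meas.comp (measurable_prodMk_left (x := z))).aestronglyMeasurable
  · filter_upwards with ξ
    exact (h.bd1 z ξ).trans (le_abs_self _)

lemma Sy.integrable {K : ℝ → E2 → ℂ} {A : E2 → ℝ} (h : Sy K A)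
    (hA : MemLp A 2 (volume : Measure E2)) {z : ℝ} (hz : z ≠ 0) : Integrable (K z) := by
  have hi : Integrable (fun ξ => (z^2)⁻¹ * (A ξ * ((sig ξ)^2)⁻¹)) :=
    (hA.integrable_mul sig_memLp).const_mul _
  refine hi.mono' (h.memLp hA z).1 ?_
  filter_upwards with ξ
  refine (h.bd' z ξ).trans ?_
  have := h.A_nonneg ξ
  have hs := sig_pos ξ
  have : dz (sig ξ * z) ≤ (z^2)⁻¹ * ((sig ξ)^2)⁻¹ := by
    rw [← mul_inv]
    unfold dz
    apply inv_anti₀ (by positivity)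
    rw [abs_mul, abs_of_pos hs, ← sq_abs z]
    nlinarith [abs_nonneg z, mul_nonneg hs.le (abs_nonneg z)]
  calc A ξ * dz (sig ξ * z) ≤ A ξ * ((z^2)⁻¹ * ((sig ξ)^2)⁻¹) := by gcongr
    _ = _ := by ring

lemma ae_ne (a : ℝ) : ∀ᵐ z : ℝ, z ≠ a := by
  simp [ae_iff]

lemma Sy.slices {K : ℝ → E2 → ℂ} {A : E2 → ℝ} (h : Sy K A)
    (hA : MemLp A 2 (volume : Measure E2)) :
    ∀ᵐ z : ℝ, Integrable (K z) ∧ MemLp (K z) 2 (volume : Measure E2) := by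
  filter_upwards [ae_ne 0] with z hz using ⟨h.integrable hA hz, h.memLp hA z⟩

lemma Sy.l2K {K : ℝ → E2 → ℂ} {A : E2 → ℝ} (h : Sy K A) :
    ∫⁻ ξ, ∫⁻ z, ‖K z ξ‖ₑ ^ 2 ≤ c0 * ∫⁻ ξ, ENNReal.ofReal (A ξ ^ 2) := by
  rw [← lintegral_const_mul' _ _ c0_lt.ne]
  apply lintegral_mono
  intro ξ
  have h0 := h.A_nonneg ξ
  calc ∫⁻ z, ‖K z ξ‖ₑ ^ 2 ≤ ∫⁻ z, ENNReal.ofReal (A ξ ^ 2) * ENNReal.ofReal (dz z) := by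
        apply lintegral_mono
        intro z
        dsimp only
        rw [← ENNReal.ofReal_mul (by positivity), ← ofReal_norm, ← ENNReal.ofReal_pow (norm_nonneg _)]
        apply ENNReal.ofReal_le_ofReal
        have h1 := h.bd' z ξ
        have h2 : dz (sig ξ * z) ≤ dz z := by
          unfold dz
          apply inv_anti₀ (by positivity)
          rw [abs_mul, abs_of_pos (sig_pos ξ)]
          have := sig_one ξ
          gcongr
          nlinarith [abs_nonneg z]
        have h3 := dz_nonneg (sig ξ * z)
        have h4 := dz_le_one (sig ξ * z)
        calc ‖K z ξ‖^2 ≤ (A ξ * dz (sig ξ * z))^2 := by gcongr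
          _ = A ξ ^ 2 * (dz (sig ξ * z) * dz (sig ξ * z)) := by ring
          _ ≤ A ξ ^ 2 * (dz z * 1) := by gcongr; exact dz_nonneg z
          _ = _ := by ring
    _ = ENNReal.ofReal (A ξ ^ 2) * c0 := lintegral_const_mul' _ _ ENNReal.ofReal_ne_top
    _ = _ := mul_comm _ _

lemma Sy.l2 {K : ℝ → E2 → ℂ} {A : E2 → ℝ} (h : Sy K A)
    (hA : MemLp A 2 (volume : Measure E2)) :
    ∫⁻ x : E3, ‖TC K x‖ₑ ^ 2 ≤ c0 * ∫⁻ ξ, ENNReal.ofReal (A ξ ^ 2) := by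
  rw [TC_lint h.meas (h.slices hA)]
  exact h.l2K

lemma A_fin {A : E2 → ℝ} (hA : MemLp A 2 (volume : Measure E2)) :
    ∫⁻ ξ, ENNReal.ofReal (A ξ ^ 2) < ⊤ := hA.integrable_sq.lintegral_lt_top

lemma memLp_of_lint {α : Type*} [MeasurableSpace α] {μ : Measure α} {f : α → ℂ}
    (hf : AEStronglyMeasurable f μ) (h : ∫⁻ x, ‖f x‖ₑ ^ 2 ∂μ < ⊤) : MemLp f 2 μ := by
  refine ⟨hf, ?_⟩
  rw [lint_sq_eq] at h
  by_contra hc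
  rw [not_lt, top_le_iff] at hc
  simp [hc] at h

lemma Sy.memLp_TC {K : ℝ → E2 → ℂ} {A : E2 → ℝ} (h : Sy K A)
    (hA : MemLp A 2 (volume : Measure E2)) : MemLp (TC K) 2 (volume : Measure E3) :=
  memLp_of_lint (TC_meas h.meas).aestronglyMeasurable
    ((h.l2 hA).trans_lt (ENNReal.mul_lt_top c0_lt (A_fin hA)))

lemma Sy.memLp_K {K : ℝ → E2 → ℂ} {A : E2 → ℝ} (h : Sy K A)
    (hA : MemLp A 2 (volume : Measure E2)) :
    MemLp (Function.uncurry K) 2 (volume.prod volume : Measure (ℝ × E2)) := by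
  refine memLp_of_lint h.meas.aestronglyMeasurable ?_
  rw [lintegral_prod_symm _ (h.meas.enorm.pow_const 2).aemeasurable]
  exact h.l2K.trans_lt (ENNReal.mul_lt_top c0_lt (A_fin hA))


/-- capped modulus to the power 3/2 -/
def mu (t : ℝ) : ℝ := min (2 * t) 2
def gm (t : ℝ) : ℝ := mu t * √(mu t)

lemma mu_cont : Continuous mu := by unfold mu; fun_prop
lemma gm_cont : Continuous gm := by
  unfold gm; exact mu_cont.mul (mu_cont.sqrt)
lemma mu_nonneg {t : ℝ} (ht : 0 ≤ t) : 0 ≤ mu t := le_min (by linarith) (by norm_num)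
lemma gm_nonneg {t : ℝ} (ht : 0 ≤ t) : 0 ≤ gm t := mul_nonneg (mu_nonneg ht) (Real.sqrt_nonneg _)

def wt (h : E3) : ℝ≥0∞ := ENNReal.ofReal ((‖h‖^4)⁻¹)
def c1 : ℝ≥0∞ := ∫⁻ h : E3, wt h * ENNReal.ofReal (gm ‖h‖)

lemma wt_meas : Measurable wt := by unfold wt; fun_prop

lemma gm_le1 {t : ℝ} (ht : 0 ≤ t) : gm t ≤ 4 * (t * √t) := by
  unfold gm
  have h1 : mu t ≤ 2 * t := min_le_left _ _
  have h2 : √(mu t) ≤ 2 * √t := by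
    rw [show (2:ℝ) * √t = √(4 * t) by
      rw [Real.sqrt_mul (by norm_num), show (4:ℝ) = 2^2 by norm_num, Real.sqrt_sq (by norm_num)]]
    apply Real.sqrt_le_sqrt; linarith
  have := mul_le_mul h1 h2 (Real.sqrt_nonneg _) (by linarith)
  linarith

lemma gm_le2 (t : ℝ) : gm t ≤ 4 := by
  unfold gm
  have h1 : mu t ≤ 2 := min_le_right _ _
  have h2 : √(mu t) ≤ 2 := by
    apply Real.sqrt_le_iff.2 ⟨by norm_num, by linarith⟩
  have := mul_le_mul h1 h2 (Real.sqrt_nonneg _) (by norm_num)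
  linarith

lemma c1_lt : c1 < ⊤ := by
  have h : Integrable (fun h : E3 => (fun r : ℝ => (r^4)⁻¹ * gm r) ‖h‖) := by
    refine (integrable_fun_norm_addHaar (volume : Measure E3)
      (f := fun r : ℝ => (r^4)⁻¹ * gm r)).2 ?_
    simp only [finrank_euclideanSpace, Fintype.card_fin, smul_eq_mul]
    have hm : Measurable (fun y : ℝ => y ^ (3 - 1) * ((y ^ 4)⁻¹ * gm y)) := by
      have := gm_cont.measurable
      fun_prop
    rw [← Ioc_union_Ioi_eq_Ioi (zero_le_one (α := ℝ)), integrableOn_union]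
    constructor
    · have hi : IntegrableOn (fun y : ℝ => 4 * y^(-(1/2):ℝ)) (Ioc 0 1) := by
        have := (intervalIntegral.intervalIntegrable_rpow' (a := 0) (b := 1)
          (r := -(1/2)) (by norm_num)).const_mul 4
        rwa [intervalIntegrable_iff_integrableOn_Ioc_of_le zero_le_one] at this
      refine hi.mono' hm.aestronglyMeasurable ?_
      refine (ae_restrict_iff' measurableSet_Ioc).2 (Filter.Eventually.of_forall fun y hy => ?_)
      have hy0 : 0 < y := hy.1
      rw [Real.norm_of_nonneg (by have := gm_nonneg hy0.le; positivity)]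
      rw [Real.rpow_neg hy0.le, ← Real.sqrt_eq_rpow]
      have h1 := gm_le1 hy0.le
      have hs : 0 < √y := Real.sqrt_pos.2 hy0
      have hss : √y * √y = y := Real.mul_self_sqrt hy0.le
      calc y^(3-1) * ((y^4)⁻¹ * gm y) ≤ y^(3-1) * ((y^4)⁻¹ * (4 * (y * √y))) := by gcongr
        _ = 4 * (√y)⁻¹ := by
          field_simp
          rw [Real.sq_sqrt hy0.le]; ring
    · have hi : IntegrableOn (fun y : ℝ => 4 * y^(-2:ℝ)) (Ioi 1) :=
        (integrableOn_Ioi_rpow_of_lt (by norm_num) one_pos).const_mul 4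
      refine hi.mono' hm.aestronglyMeasurable ?_
      refine (ae_restrict_iff' measurableSet_Ioi).2 (Filter.Eventually.of_forall fun y hy => ?_)
      have hy0 : 0 < y := one_pos.trans hy
      rw [Real.norm_of_nonneg (by have := gm_nonneg hy0.le; positivity)]
      rw [Real.rpow_neg hy0.le]
      have h1 := gm_le2 y
      calc y^(3-1) * ((y^4)⁻¹ * gm y) ≤ y^(3-1) * ((y^4)⁻¹ * 4) := by gcongr
        _ = 4 * (y^(2:ℝ))⁻¹ := by
          norm_cast
          field_simp
  have h2 := h.lintegral_lt_top
  refine lt_of_eq_of_lt ?_ h2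
  unfold c1 wt
  congr 1; ext x
  rw [ENNReal.ofReal_mul (by positivity)]

lemma c1_scale {s : ℝ} (hs : 0 < s) :
    ∫⁻ h : E3, wt h * ENNReal.ofReal (gm (s * ‖h‖)) = ENNReal.ofReal s * c1 := by
  have hm : Measurable (fun h : E3 => wt h * ENNReal.ofReal (gm ‖h‖)) :=
    wt_meas.mul (ENNReal.measurable_ofReal.comp (gm_cont.comp continuous_norm).measurable)
  have := lint_smul hm hs
  have e : ∀ h : E3, wt h * ENNReal.ofReal (gm (s * ‖h‖))
      = ENNReal.ofReal (s^4) * (wt (s • h) * ENNReal.ofReal (gm ‖s • h‖)) := by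
    intro h
    rw [norm_smul, Real.norm_of_nonneg hs.le, ← mul_assoc]
    congr 1
    unfold wt
    rw [← ENNReal.ofReal_mul (by positivity), norm_smul, Real.norm_of_nonneg hs.le]
    congr 1
    by_cases h0 : ‖h‖ = 0
    · simp [h0]
    · field_simp
  simp_rw [e]
  rw [lintegral_const_mul' _ _ ENNReal.ofReal_ne_top, this, ← mul_assoc,
    ← ENNReal.ofReal_mul (by positivity)]
  unfold c1
  congr 2
  simp only [finrank_euclideanSpace, Fintype.card_fin]
  field_simp

lemma sig_two_pi (ξ : E2) : 2 * π * ‖ξ‖ ≤ sig ξ := by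
  have h : ∀ j, 2 * π * |ξ j| ≤ ‖sj j ξ‖ := fun j => by
    have := Complex.abs_im_le_norm (sj j ξ)
    rw [sj_im, abs_mul, abs_of_pos (by positivity)] at this
    exact this
  have : ‖ξ‖ ≤ |ξ 0| + |ξ 1| := by
    rw [EuclideanSpace.norm_eq]
    apply Real.sqrt_le_iff.2 ⟨by positivity, ?_⟩
    simp [Fin.sum_univ_two]
    nlinarith [abs_nonneg (ξ 0), abs_nonneg (ξ 1), sq_abs (ξ 0), sq_abs (ξ 1),
      mul_nonneg (abs_nonneg (ξ 0)) (abs_nonneg (ξ 1))]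
  have h3 := mul_le_mul_of_nonneg_left this (by positivity : 0 ≤ 2 * π)
  unfold sig; linarith [h 0, h 1]

/-- phase -/
def ph (h : E3) (ξ : E2) : ℂ := Complex.exp (Complex.I * ((2 * π * ⟪ξ, pr h⟫ : ℝ) : ℂ))

lemma ph_norm (h : E3) (ξ : E2) : ‖ph h ξ‖ = 1 := Complex.norm_exp_I_mul_ofReal _

lemma ph_sub (h : E3) (ξ : E2) : ‖ph h ξ - 1‖ ≤ sig ξ * ‖h‖ := by
  refine Real.norm_exp_I_mul_ofReal_sub_one_le.trans ?_
  rw [Real.norm_eq_abs, abs_mul, abs_of_pos (by positivity)]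
  calc 2 * π * |⟪ξ, pr h⟫| ≤ 2 * π * (‖ξ‖ * ‖pr h‖) := by
        gcongr; exact abs_real_inner_le_norm _ _
    _ = (2 * π * ‖ξ‖) * ‖pr h‖ := by ring
    _ ≤ _ := by
      gcongr
      · exact (sig_pos ξ).le
      · exact sig_two_pi ξ
      · exact pr_norm h

def Dl (K : ℝ → E2 → ℂ) (h : E3) (z : ℝ) (ξ : E2) : ℂ := ph h ξ * K (z + h 2) ξ - K z ξ

lemma Dl_meas {K : ℝ → E2 → ℂ} (hK : Measurable (Function.uncurry K)) :
    Measurable (fun p : E3 × ℝ × E2 => Dl K p.1 p.2.1 p.2.2) := by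
  unfold Dl ph
  have := pr_cont
  have h1 : Measurable (fun p : E3 × ℝ × E2 => K (p.2.1 + p.1 2) p.2.2) :=
    hK.comp (f := fun p : E3 × ℝ × E2 => (p.2.1 + p.1 2, p.2.2)) (by fun_prop)
  have h2 : Measurable (fun p : E3 × ℝ × E2 => K (p.2.1) p.2.2) :=
    hK.comp (f := fun p : E3 × ℝ × E2 => (p.2.1, p.2.2)) (by fun_prop)
  fun_prop

lemma inv_shift {b : E2 → ℂ} (y : E2) (h : E3) :
    𝓕⁻ b (y + pr h) = 𝓕⁻ (fun ξ => ph h ξ * b ξ) y := by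
  simp_rw [Real.fourierInv_eq']
  congr 1; ext ξ
  unfold ph
  rw [smul_eq_mul, smul_eq_mul, ← mul_assoc, ← Complex.exp_add, inner_add_right]
  congr 2
  push_cast; ring

lemma ph_cont (h : E3) : Continuous (ph h) := by unfold ph; fun_prop

lemma ph_memLp {b : E2 → ℂ} {p : ℝ≥0∞} (hb : MemLp b p (volume : Measure E2)) (h : E3) :
    MemLp (fun ξ => ph h ξ * b ξ) p (volume : Measure E2) := by
  refine hb.mono ((ph_cont h).aestronglyMeasurable.mul hb.1) ?_
  filter_upwards with ξ
  rw [norm_mul, ph_norm, one_mul]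

lemma inv_sub {b g : E2 → ℂ} (hb : Integrable b) (hg : Integrable g) (y : E2) :
    𝓕⁻ (fun ξ => b ξ - g ξ) y = 𝓕⁻ b y - 𝓕⁻ g y := by
  simp_rw [Real.fourierInv_eq]
  rw [← integral_sub]
  · simp_rw [smul_sub]
  · exact (Real.fourierIntegral_convergent_iff (V := E2) (-y) |>.2 hb).congr (by simp)
  · exact (Real.fourierIntegral_convergent_iff (V := E2) (-y) |>.2 hg).congr (by simp)

lemma Sy.diff_lint {K : ℝ → E2 → ℂ} {A : E2 → ℝ} (h : Sy K A)
    (hA : MemLp A 2 (volume : Measure E2)) (k : E3) :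
    ∫⁻ x : E3, ‖TC K (x + k) - TC K x‖ₑ ^ 2 = ∫⁻ ξ, ∫⁻ z, ‖Dl K k z ξ‖ₑ ^ 2 := by
  have hm : Measurable (Function.uncurry (Dl K k)) :=
    (Dl_meas h.meas).comp (f := fun p : ℝ × E2 => (k, p)) (by fun_prop)
  have hsl : ∀ z : ℝ, z ≠ 0 → z ≠ - k 2 → Integrable (fun ξ => ph k ξ * K (z + k 2) ξ) ∧
      Integrable (K z) := by
    intro z h1 h2
    refine ⟨?_, h.integrable hA h1⟩
    have := (h.integrable hA (z := z + k 2) (fun hc => h2 (by linarith)))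
    exact memLp_one_iff_integrable.1 (ph_memLp (memLp_one_iff_integrable.2 this) k)
  rw [← TC_lint hm]
  · have hae : ∀ᵐ x : E3, x 2 ≠ 0 ∧ x 2 ≠ - k 2 := by
      have h1 : ∀ᵐ p : ℝ × E2, p.1 ≠ 0 ∧ p.1 ≠ - k 2 := by
        rw [Measure.volume_eq_prod]
        have := (ae_ne 0).and (ae_ne (- k 2))
        exact Measure.quasiMeasurePreserving_fst.ae this
      have := e3_mp.quasiMeasurePreserving.ae h1
      simpa only [e3_apply] using this
    apply lintegral_congr_ae
    filter_upwards [hae] with x hx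
    congr 2
    obtain ⟨h1, h2⟩ := hsl _ hx.1 hx.2
    unfold TC Dl
    rw [inv_sub h1 h2, pr_add, inv_shift]
    simp
  · filter_upwards [ae_ne 0, ae_ne (- k 2)] with z h1 h2
    obtain ⟨h3, h4⟩ := hsl z h1 h2
    exact ⟨h3.sub h4, (ph_memLp (h.memLp hA _) k).sub (h.memLp hA z)⟩

lemma Sy.Dl_bd {K : ℝ → E2 → ℂ} {A : E2 → ℝ} (h : Sy K A) (k : E3) (z : ℝ) (ξ : E2) :
    ‖Dl K k z ξ‖ ^ 2 ≤ A ξ ^ 2 * gm (sig ξ * ‖k‖) *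
      (dz (sig ξ * (z + k 2)) + dz (sig ξ * z)) := by
  set a := dz (sig ξ * (z + k 2)) with ha
  set b := dz (sig ξ * z) with hb
  set N := ‖Dl K k z ξ‖ with hN
  have ha0 : 0 ≤ a := dz_nonneg _
  have hb0 : 0 ≤ b := dz_nonneg _
  have hA := h.A_nonneg ξ
  have hN0 : 0 ≤ N := norm_nonneg _
  have hs := sig_pos ξ
  have b1 : N ≤ A ξ * (a^2 + b^2) := by
    refine (norm_sub_le _ _).trans ?_
    rw [norm_mul, ph_norm, one_mul]
    linarith [h.bd (z + k 2) ξ, h.bd z ξ]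
  have b2 : N ≤ A ξ * (2 * (sig ξ * ‖k‖)) := by
    have e : Dl K k z ξ = (ph k ξ - 1) * K (z + k 2) ξ + (K (z + k 2) ξ - K z ξ) := by
      unfold Dl; ring
    rw [hN, e]
    refine (norm_add_le _ _).trans ?_
    have h1 := h.lip (z + k 2) z ξ
    rw [add_sub_cancel_left] at h1
    have h2 : A ξ * sig ξ * |k 2| ≤ A ξ * sig ξ * ‖k‖ := by
      gcongr; exact x2_norm k
    have h3 : ‖(ph k ξ - 1) * K (z + k 2) ξ‖ ≤ (sig ξ * ‖k‖) * A ξ := by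
      rw [norm_mul]
      exact mul_le_mul (ph_sub k ξ) (h.bd1 _ _) (norm_nonneg _) (by positivity)
    nlinarith
  have b3 : N ≤ A ξ * mu (sig ξ * ‖k‖) := by
    unfold mu
    rw [mul_min_of_nonneg _ _ hA]
    refine le_min b2 (b1.trans ?_)
    have := dz_le_one (sig ξ * (z + k 2))
    have := dz_le_one (sig ξ * z)
    gcongr
    nlinarith
  have hm0 : 0 ≤ mu (sig ξ * ‖k‖) := mu_nonneg (by positivity)
  have b4 : √N ≤ √(A ξ) * √(mu (sig ξ * ‖k‖)) := by
    rw [← Real.sqrt_mul hA]; exact Real.sqrt_le_sqrt b3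
  have b5 : √N ≤ √(A ξ) * (a + b) := by
    have : √((a+b)^2) = a + b := Real.sqrt_sq (by positivity)
    rw [← this, ← Real.sqrt_mul hA]
    apply Real.sqrt_le_sqrt
    refine b1.trans ?_
    gcongr
    nlinarith [mul_nonneg ha0 hb0]
  have e1 : N^2 = N * (√N * √N) := by rw [Real.mul_self_sqrt hN0, sq]
  have e2 : √(A ξ) * √(A ξ) = A ξ := Real.mul_self_sqrt hA
  rw [e1]
  calc N * (√N * √N) ≤ (A ξ * mu (sig ξ * ‖k‖)) *
        ((√(A ξ) * √(mu (sig ξ * ‖k‖))) * (√(A ξ) * (a + b))) := by gcongr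
    _ = A ξ * (√(A ξ) * √(A ξ)) * (mu (sig ξ * ‖k‖) * √(mu (sig ξ * ‖k‖))) * (a + b) := by ring
    _ = _ := by rw [e2]; unfold gm; ring

lemma Sy.Dl_lint {K : ℝ → E2 → ℂ} {A : E2 → ℝ} (h : Sy K A) (k : E3) (ξ : E2) :
    ∫⁻ z, ‖Dl K k z ξ‖ₑ ^ 2 ≤ ENNReal.ofReal (A ξ ^ 2) * ENNReal.ofReal (gm (sig ξ * ‖k‖)) *
      (2 * (ENNReal.ofReal (sig ξ)⁻¹ * c0)) := by
  have hs := sig_pos ξ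
  have hg : 0 ≤ gm (sig ξ * ‖k‖) := gm_nonneg (by positivity)
  have hm : Measurable (fun z : ℝ => ENNReal.ofReal (dz (sig ξ * z))) := by
    have := dz_cont
    fun_prop
  have hm2 : Measurable (fun z : ℝ => ENNReal.ofReal (dz (sig ξ * (z + k 2)))) := by
    have := dz_cont
    fun_prop
  calc ∫⁻ z, ‖Dl K k z ξ‖ₑ ^ 2 ≤ ∫⁻ z, ENNReal.ofReal (A ξ ^ 2) *
        ENNReal.ofReal (gm (sig ξ * ‖k‖)) * (ENNReal.ofReal (dz (sig ξ * (z + k 2))) +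
          ENNReal.ofReal (dz (sig ξ * z))) := by
        apply lintegral_mono
        intro z
        dsimp only
        rw [← ENNReal.ofReal_mul (by positivity), ← ENNReal.ofReal_add (dz_nonneg _) (dz_nonneg _),
          ← ENNReal.ofReal_mul (by positivity), ← ofReal_norm,
          ← ENNReal.ofReal_pow (norm_nonneg _)]
        exact ENNReal.ofReal_le_ofReal (h.Dl_bd k z ξ)
    _ = _ := by
      rw [lintegral_const_mul' _ _ (ENNReal.mul_ne_top ENNReal.ofReal_ne_top ENNReal.ofReal_ne_top),
        lintegral_add_left hm2,
        lintegral_add_right_eq_self (fun z : ℝ => ENNReal.ofReal (dz (sig ξ * z))) (k 2),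
        c0_scale hs, two_mul]

lemma Sy.gag {K : ℝ → E2 → ℂ} {A : E2 → ℝ} (h : Sy K A)
    (hA : MemLp A 2 (volume : Measure E2)) :
    ∫⁻ q : E3 × E3, wt (q.1 - q.2) * ‖TC K q.1 - TC K q.2‖ₑ ^ 2 ∂(volume.prod volume)
      ≤ (2 * c0 * c1) * ∫⁻ ξ, ENNReal.ofReal (A ξ ^ 2) := by
  have hT := TC_meas h.meas
  have hm : Measurable (fun q : E3 × E3 => wt (q.1 - q.2) * ‖TC K q.1 - TC K q.2‖ₑ ^ 2) := by
    have := wt_meas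
    fun_prop
  rw [lintegral_prod_symm _ hm.aemeasurable]
  have e1 : ∀ y : E3, ∫⁻ x, wt (x - y) * ‖TC K x - TC K y‖ₑ ^ 2
      = ∫⁻ k, wt k * ‖TC K (y + k) - TC K y‖ₑ ^ 2 := by
    intro y
    rw [← lintegral_add_left_eq_self (fun x => wt (x - y) * ‖TC K x - TC K y‖ₑ ^ 2) y]
    simp
  simp_rw [e1]
  rw [lintegral_lintegral_swap]
  swap
  · have := wt_meas
    apply Measurable.aemeasurable
    unfold Function.uncurry
    fun_prop
  have e2 : ∀ k : E3, ∫⁻ y, wt k * ‖TC K (y + k) - TC K y‖ₑ ^ 2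
      = ∫⁻ ξ, wt k * ∫⁻ z, ‖Dl K k z ξ‖ₑ ^ 2 := by
    intro k
    have hw : wt k ≠ ⊤ := ENNReal.ofReal_ne_top
    rw [lintegral_const_mul' _ _ hw, h.diff_lint hA k, lintegral_const_mul' _ _ hw]
  simp_rw [e2]
  rw [lintegral_lintegral_swap]
  swap
  · apply Measurable.aemeasurable
    unfold Function.uncurry
    refine (wt_meas.comp measurable_fst).mul ?_
    have : Measurable (fun q : (E3 × E2) × ℝ => ‖Dl K q.1.1 q.2 q.1.2‖ₑ ^ 2) :=
      ((Dl_meas h.meas).comp (f := fun q : (E3 × E2) × ℝ => (q.1.1, q.2, q.1.2))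
        (by fun_prop)).enorm.pow_const 2
    exact this.lintegral_prod_right'
  rw [← lintegral_const_mul' _ _ (ENNReal.mul_ne_top (ENNReal.mul_ne_top (by simp) c0_lt.ne) c1_lt.ne)]
  apply lintegral_mono
  intro ξ
  have hs := sig_pos ξ
  calc ∫⁻ k, wt k * ∫⁻ z, ‖Dl K k z ξ‖ₑ ^ 2
      ≤ ∫⁻ k, (ENNReal.ofReal (A ξ ^ 2) * (2 * (ENNReal.ofReal (sig ξ)⁻¹ * c0))) *
        (wt k * ENNReal.ofReal (gm (sig ξ * ‖k‖))) := by
        apply lintegral_mono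
        intro k
        dsimp only
        refine (mul_le_mul_right (h.Dl_lint k ξ) _).trans (le_of_eq ?_)
        ring
    _ = (ENNReal.ofReal (sig ξ)⁻¹ * ENNReal.ofReal (sig ξ)) * (2 * c0 * c1 * ENNReal.ofReal (A ξ ^ 2)) := by
      rw [lintegral_const_mul' _ _ (ENNReal.mul_ne_top ENNReal.ofReal_ne_top
        (ENNReal.mul_ne_top (by simp) (ENNReal.mul_ne_top ENNReal.ofReal_ne_top c0_lt.ne))),
        c1_scale hs]
      ring
    _ = _ := by
      rw [← ENNReal.ofReal_mul (by positivity), inv_mul_cancel₀ hs.ne', ENNReal.ofReal_one, one_mul]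


/-- test functions -/
structure Tst (φ : E3 → ℝ) : Prop where
  sm : ContDiff ℝ ∞ φ
  cs : HasCompactSupport φ

lemma Tst.deriv {φ : E3 → ℝ} (h : Tst φ) (d : E3) : Tst (fun x => fderiv ℝ φ x d) :=
  ⟨(h.sm.fderiv_right (m := ∞) (by simp)).clm_apply contDiff_const,
    h.cs.fderiv_apply (𝕜 := ℝ) d⟩

def sl (φ : E3 → ℝ) (z : ℝ) (y : E2) : ℂ := (φ (jn z y) : ℂ)
def Ph (φ : E3 → ℝ) (z : ℝ) (ξ : E2) : ℂ := 𝓕⁻ (sl φ z) ξ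

lemma jn_cont : Continuous (fun p : ℝ × E2 => jn p.1 p.2) := by unfold jn; fun_prop

lemma jn_smooth (z : ℝ) : ContDiff ℝ ∞ (jn z) := by
  unfold jn
  rw [contDiff_euclidean]
  intro i
  fin_cases i <;> simp <;> fun_prop

lemma jn_dist (z : ℝ) : Isometry (jn z) := by
  apply Isometry.of_dist_eq
  intro x y
  rw [EuclideanSpace.dist_eq, EuclideanSpace.dist_eq]
  simp [Fin.sum_univ_succ, jn]

lemma jn_norm (z : ℝ) (y : E2) : ‖y‖ ≤ ‖jn z y‖ := by
  have := pr_norm (jn z y)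
  have h := congrArg Prod.snd (e3_jn z y)
  rw [e3_apply] at h
  simp only at h
  rwa [h] at this

lemma jn_norm2 (z : ℝ) (y : E2) : |z| ≤ ‖jn z y‖ := by
  have := x2_norm (jn z y)
  simpa [jn] using this

lemma Tst.sl_sm {φ : E3 → ℝ} (h : Tst φ) (z : ℝ) : ContDiff ℝ ∞ (sl φ z) :=
  Complex.ofRealCLM.contDiff.comp (h.sm.comp (jn_smooth z))

lemma Tst.sl_cs {φ : E3 → ℝ} (h : Tst φ) (z : ℝ) : HasCompactSupport (sl φ z) := by
  have h1 : HasCompactSupport (φ ∘ jn z) := h.cs.comp_isClosedEmbedding (jn_dist z).isClosedEmbedding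
  exact h1.comp_left (g := fun t : ℝ => (t : ℂ)) rfl

def Tst.sch {φ : E3 → ℝ} (h : Tst φ) (z : ℝ) : 𝓢(E2, ℂ) := (h.sl_cs z).toSchwartzMap (h.sl_sm z)

lemma Tst.sch_coe {φ : E3 → ℝ} (h : Tst φ) (z : ℝ) : (h.sch z : E2 → ℂ) = sl φ z := rfl

lemma Tst.sl_meas {φ : E3 → ℝ} (h : Tst φ) : Measurable (Function.uncurry (sl φ)) := by
  have := (Complex.continuous_ofReal.comp (h.sm.continuous.comp jn_cont)).measurable
  exact this

lemma Tst.Ph_meas {φ : E3 → ℝ} (h : Tst φ) : Measurable (Function.uncurry (Ph φ)) :=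
  (inv_meas h.sl_meas).measurable

lemma Tst.sl_int {φ : E3 → ℝ} (h : Tst φ) (z : ℝ) : Integrable (sl φ z) :=
  (h.sl_sm z).continuous.integrable_of_hasCompactSupport (h.sl_cs z)

lemma Tst.sl_memLp {φ : E3 → ℝ} (h : Tst φ) (z : ℝ) : MemLp (sl φ z) 2 (volume : Measure E2) :=
  (h.sl_sm z).continuous.memLp_of_hasCompactSupport (h.sl_cs z)

lemma Tst.memLp {φ : E3 → ℝ} (h : Tst φ) : MemLp (fun x => (φ x : ℂ)) 2 (volume : Measure E3) :=
  memLp_ofReal (h.sm.continuous.memLp_of_hasCompactSupport h.cs)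

lemma Tst.Ph_memLp {φ : E3 → ℝ} (h : Tst φ) :
    MemLp (Function.uncurry (Ph φ)) 2 (volume.prod volume : Measure (ℝ × E2)) := by
  refine memLp_of_lint h.Ph_meas.aestronglyMeasurable ?_
  rw [lintegral_prod _ (h.Ph_meas.enorm.pow_const 2).aemeasurable]
  have e : ∀ z, ∫⁻ y, ‖Function.uncurry (Ph φ) (z, y)‖ₑ ^ 2 = ∫⁻ y, ‖sl φ z y‖ₑ^2 := by
    intro z
    rw [← planch (h.sl_int z) (h.sl_memLp z)]
    rfl
  simp_rw [e]
  have hm : Measurable (fun p : ℝ × E2 => ‖sl φ p.1 p.2‖ₑ^2) := h.sl_meas.enorm.pow_const 2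
  have h2 := lint_e3 hm
  rw [← h2]
  have e2 : ∀ x : E3, sl φ (x 2) (pr x) = (φ x : ℂ) := by
    intro x
    unfold sl
    have := e3_symm (e3 x)
    rw [e3.symm_apply_apply, e3_apply] at this
    rw [← this]
  simp_rw [e2]
  rw [lint_sq_eq]
  exact ENNReal.pow_lt_top h.memLp.2

lemma jn_pr (x : E3) : jn (x 2) (pr x) = x := by
  have := e3_symm (e3 x)
  rw [e3.symm_apply_apply, e3_apply] at this
  exact this.symm

lemma pairK_int {K : ℝ → E2 → ℂ} {A : E2 → ℝ} (h : Sy K A)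
    (hA : MemLp A 2 (volume : Measure E2)) {φ : E3 → ℝ} (hφ : Tst φ) (S : Set ℝ) :
    Integrable (fun p : ℝ × E2 => K p.1 p.2 * Ph φ p.1 p.2) ((volume.restrict S).prod volume) := by
  have := (h.memLp_K hA).integrable_mul hφ.Ph_memLp
  have h2 := this.restrict (s := S ×ˢ univ)
  rw [← Measure.prod_restrict, Measure.restrict_univ] at h2
  exact h2

lemma pair {K : ℝ → E2 → ℂ} {A : E2 → ℝ} (h : Sy K A)
    (hA : MemLp A 2 (volume : Measure E2)) {φ : E3 → ℝ} (hφ : Tst φ) (S : Set ℝ) :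
    ∫ x in {x : E3 | x 2 ∈ S}, TC K x * φ x = ∫ z in S, ∫ ξ, K z ξ * Ph φ z ξ := by
  let F : ℝ × E2 → ℂ := fun p => 𝓕⁻ (K p.1) p.2 * sl φ p.1 p.2
  have hF : ∀ x : E3, F (e3 x) = TC K x * φ x := by
    intro x
    rw [e3_apply]
    simp only [F, sl, jn_pr, TC]
  have hset : {x : E3 | x 2 ∈ S} = e3 ⁻¹' (S ×ˢ univ) := by
    ext x; simp [e3_apply]
  have h1 := e3_mp.setIntegral_preimage_emb e3.measurableEmbedding F (S ×ˢ univ)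
  simp_rw [hF] at h1
  rw [hset, h1]
  have hinteg : Integrable F (volume.prod volume) := by
    have h2 : Integrable (fun x : E3 => F (e3 x)) := by
      simp_rw [hF]
      exact (h.memLp_TC hA).integrable_mul hφ.memLp
    exact (e3_mp.integrable_comp_emb e3.measurableEmbedding).1 h2
  rw [Measure.volume_eq_prod, setIntegral_prod F hinteg.integrableOn, Measure.restrict_univ]
  apply integral_congr_ae
  filter_upwards [ae_restrict_of_ae (h.slices hA)] with z hz
  exact inv_pair hz.1 (hφ.sl_int z)

lemma Ph_horiz {φ : E3 → ℝ} (hφ : Tst φ) (d : Fin 2) (z : ℝ) (ξ : E2) :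
    Ph (fun x => fderiv ℝ φ x (stdb3 d.castSucc)) z ξ
      = -((2 * π * Complex.I * (ξ d : ℂ)) * Ph φ z ξ) := by
  have hd := hφ.deriv (stdb3 d.castSucc)
  have e : hd.sch z = LineDeriv.lineDerivOp (EuclideanSpace.single d 1 : E2) (hφ.sch z) := by
    ext y
    rw [SchwartzMap.lineDerivOp_apply_eq_fderiv, hd.sch_coe, hφ.sch_coe]
    have h1 : HasFDerivAt φ (fderiv ℝ φ (jn z y)) (jn z y) :=
      (hφ.sm.differentiable (by simp) _).hasFDerivAt
    have h2 : HasFDerivAt (jn z) (fderiv ℝ (jn z) y) y :=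
      ((jn_smooth z).differentiable (by simp) _).hasFDerivAt
    have h3 : HasFDerivAt (sl φ z) (Complex.ofRealCLM.comp
        ((fderiv ℝ φ (jn z y)).comp (fderiv ℝ (jn z) y))) y :=
      (Complex.ofRealCLM.hasFDerivAt).comp y (h1.comp y h2)
    rw [h3.fderiv]
    have h4 : fderiv ℝ (jn z) y (EuclideanSpace.single d 1) = stdb3 d.castSucc := by
      have h5 : HasLineDerivAt ℝ (jn z) (stdb3 d.castSucc) y (EuclideanSpace.single d 1) := by
        have e : ∀ t : ℝ, jn z (y + t • EuclideanSpace.single d 1)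
            = jn z y + t • stdb3 d.castSucc := by
          intro t
          ext i
          fin_cases d <;> fin_cases i <;> simp [jn, stdb3]
        unfold HasLineDerivAt
        simp_rw [e]
        have := ((hasDerivAt_id (0:ℝ)).smul_const (stdb3 d.castSucc)).const_add (jn z y)
        simpa using this
      rw [← h5.lineDeriv, ((jn_smooth z).differentiable (by simp) _).lineDeriv_eq_fderiv]
    simp [sl, h4]
  have h1 := congrArg (fun f : 𝓢(E2, ℂ) => (𝓕⁻ f) ξ) e
  simp only [SchwartzMap.fourierInv_lineDerivOp_eq, SchwartzMap.fourierInv_coe, hd.sch_coe] at h1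
  have : (fun x => ⟪x, (EuclideanSpace.single d 1 : E2)⟫).HasTemperateGrowth := by fun_prop
  rw [smul_apply, SchwartzMap.smulLeftCLM_apply_apply this, SchwartzMap.fourierInv_coe,
    hφ.sch_coe] at h1
  unfold Ph
  rw [h1]
  simp [EuclideanSpace.inner_single_right]
  ring

lemma weakH {K K' : ℝ → E2 → ℂ} {A A' : E2 → ℝ} (h : Sy K A) (h' : Sy K' A')
    (hA : MemLp A 2 (volume : Measure E2)) (hA' : MemLp A' 2 (volume : Measure E2))
    {d : Fin 2} (hK : ∀ z ξ, K' z ξ = (2 * π * Complex.I * (ξ d : ℂ)) * K z ξ)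
    {φ : E3 → ℝ} (hφ : Tst φ) (S : Set ℝ) :
    ∫ x in {x : E3 | x 2 ∈ S}, TC K x * (fderiv ℝ φ x (stdb3 d.castSucc) : ℝ)
      = - ∫ x in {x : E3 | x 2 ∈ S}, TC K' x * φ x := by
  rw [pair h hA (hφ.deriv _) S, pair h' hA' hφ S]
  simp_rw [← integral_neg, Ph_horiz hφ, hK]
  congr 1; ext z; congr 1; ext ξ; ring


lemma Tst.radius {φ : E3 → ℝ} (h : Tst φ) : ∃ R : ℝ, ∀ x, R < ‖x‖ → φ x = 0 := by
  obtain ⟨R, hR⟩ := h.cs.isCompact.isBounded.subset_closedBall (0 : E3)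
  refine ⟨R, fun x hx => ?_⟩
  by_contra hc
  have := hR (subset_tsupport φ hc)
  simp at this
  linarith

lemma Tst.Ph_cs {φ : E3 → ℝ} (h : Tst φ) (ξ : E2) : HasCompactSupport (fun z => Ph φ z ξ) := by
  obtain ⟨R, hR⟩ := h.radius
  refine HasCompactSupport.intro (isCompact_Icc (a := -R) (b := R)) (fun z hz => ?_)
  have hz' : R < |z| := by
    by_contra hc
    exact hz (abs_le.1 (not_lt.1 hc))
  have : sl φ z = 0 := by
    ext y
    have := hR (jn z y) (hz'.trans_le (jn_norm2 z y))
    simp [sl, this]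
  unfold Ph
  rw [Real.fourierInv_eq', this]
  simp

lemma Ph_vert {φ : E3 → ℝ} (h : Tst φ) (z : ℝ) (ξ : E2) :
    HasDerivAt (fun z => Ph φ z ξ) (Ph (fun x => fderiv ℝ φ x (stdb3 2)) z ξ) z := by
  have hd := h.deriv (stdb3 2)
  obtain ⟨R, hR⟩ := hd.radius
  obtain ⟨C, hC⟩ := hd.cs.exists_bound_of_continuous hd.sm.continuous
  have hC0 : 0 ≤ C := (norm_nonneg _).trans (hC 0)
  unfold Ph
  simp_rw [Real.fourierInv_eq']
  have hi : ∀ (χ : E3 → ℝ), Tst χ → ∀ z, Continuous (fun v : E2 =>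
    Complex.exp (↑(2 * π * ⟪v, ξ⟫) * Complex.I) • sl χ z v) := by
    intro χ hχ z
    have := (hχ.sl_sm z).continuous
    fun_prop
  have key := hasDerivAt_integral_of_dominated_loc_of_deriv_le (μ := (volume : Measure E2))
    (s := univ) (x₀ := z) (𝕜 := ℝ)
    (F := fun z v => Complex.exp (↑(2 * π * ⟪v, ξ⟫) * Complex.I) • sl φ z v)
    (F' := fun z v => Complex.exp (↑(2 * π * ⟪v, ξ⟫) * Complex.I) •
      sl (fun x => fderiv ℝ φ x (stdb3 2)) z v)
    (bound := (Metric.closedBall (0 : E2) R).indicator (fun _ => C)) Filter.univ_mem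
    (Filter.Eventually.of_forall fun z => (hi φ h z).aestronglyMeasurable)
    ?_ (hi _ hd z).aestronglyMeasurable ?_ ?_ ?_
  · simpa only using key.2
  · apply (hi φ h z).integrable_of_hasCompactSupport
    refine (h.sl_cs z).mono ?_
    intro v hv
    rw [Function.mem_support] at hv ⊢
    intro hc
    exact hv (by rw [hc, smul_zero])
  · filter_upwards with v x _
    rw [norm_smul, Complex.norm_exp_ofReal_mul_I, one_mul]
    by_cases hv : v ∈ Metric.closedBall (0 : E2) R
    · rw [indicator_of_mem hv]
      have := hC (jn x v)
      simpa [sl] using this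
    · rw [indicator_of_notMem hv]
      have hv' : R < ‖v‖ := by simpa using hv
      have := hR (jn x v) (hv'.trans_le (jn_norm x v))
      simp [sl, this]
  · rw [integrable_indicator_iff measurableSet_closedBall]
    exact integrableOn_const (isCompact_closedBall _ _).measure_lt_top.ne
  · filter_upwards with v x _
    have h1 : HasFDerivAt φ (fderiv ℝ φ (jn x v)) (jn x v) :=
      (h.sm.differentiable (by simp) _).hasFDerivAt
    have h2 : HasDerivAt (fun t : ℝ => jn t v) (stdb3 2) x := by
      have e : ∀ t : ℝ, jn t v = jn 0 v + t • stdb3 2 := by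
        intro t
        ext i
        fin_cases i <;> simp [jn, stdb3]
      rw [show (fun t : ℝ => jn t v) = fun t => jn 0 v + t • stdb3 2 from funext e]
      have := ((hasDerivAt_id x).smul_const (stdb3 2)).const_add (jn 0 v)
      simpa using this
    have h3 : HasDerivAt (fun t : ℝ => sl φ t v)
        (sl (fun x => fderiv ℝ φ x (stdb3 2)) x v) x :=
      (h1.comp_hasDerivAt x h2).ofReal_comp
    exact h3.const_smul (Complex.exp (↑(2 * π * ⟪v, ξ⟫) * Complex.I))

lemma Sy.K_cont {K : ℝ → E2 → ℂ} {A : E2 → ℝ} (h : Sy K A) (ξ : E2) :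
    Continuous (fun z => K z ξ) := by
  have : LipschitzWith (Real.toNNReal (A ξ * sig ξ)) (fun z => K z ξ) := by
    apply LipschitzWith.of_dist_le_mul
    intro z z'
    rw [dist_eq_norm, Real.coe_toNNReal _ (mul_nonneg (h.A_nonneg ξ) (sig_pos ξ).le)]
    exact h.lip z z' ξ
  exact this.continuous

lemma vert_core {K K' : ℝ → E2 → ℂ} {A A' : E2 → ℝ} (h : Sy K A) (h' : Sy K' A')
    (hK : ∀ z ξ, HasDerivAt (fun z => K z ξ) (K' z ξ) z)
    {φ : E3 → ℝ} (hφ : Tst φ) (ξ : E2) :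
    (∫ z, (K z ξ * Ph (fun x => fderiv ℝ φ x (stdb3 2)) z ξ + K' z ξ * Ph φ z ξ) = 0) ∧
    (∫ z in Ioi (0:ℝ), (K z ξ * Ph (fun x => fderiv ℝ φ x (stdb3 2)) z ξ + K' z ξ * Ph φ z ξ)
      = - (K 0 ξ * Ph φ 0 ξ)) := by
  have hd := hφ.deriv (stdb3 2)
  have c1 : Continuous (fun z => Ph φ z ξ) :=
    continuous_iff_continuousAt.2 fun z => (Ph_vert hφ z ξ).continuousAt
  have c2 : Continuous (fun z => Ph (fun x => fderiv ℝ φ x (stdb3 2)) z ξ) :=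
    continuous_iff_continuousAt.2 fun z => (Ph_vert hd z ξ).continuousAt
  have s1 := hφ.Ph_cs ξ
  have s2 := hd.Ph_cs ξ
  have hder : ∀ z, HasDerivAt (fun z => K z ξ * Ph φ z ξ)
      (K z ξ * Ph (fun x => fderiv ℝ φ x (stdb3 2)) z ξ + K' z ξ * Ph φ z ξ) z := by
    intro z
    have := (hK z ξ).mul (Ph_vert hφ z ξ)
    rw [add_comm]
    exact this
  have hinteg : Integrable (fun z => K z ξ * Ph (fun x => fderiv ℝ φ x (stdb3 2)) z ξ
      + K' z ξ * Ph φ z ξ) := by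
    apply Integrable.add
    · exact ((h.K_cont ξ).mul c2).integrable_of_hasCompactSupport s2.mul_left
    · exact ((h'.K_cont ξ).mul c1).integrable_of_hasCompactSupport s1.mul_left
  have hFs : HasCompactSupport (fun z => K z ξ * Ph φ z ξ) := s1.mul_left
  have hFc : Continuous (fun z => K z ξ * Ph φ z ξ) := (h.K_cont ξ).mul c1
  constructor
  · exact integral_eq_zero_of_hasDerivAt_of_integrable hder hinteg
      (hFc.integrable_of_hasCompactSupport hFs)
  · have ht : Filter.Tendsto (fun z => K z ξ * Ph φ z ξ) Filter.atTop (nhds 0) := by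
      have := hFs.is_zero_at_infty
      rw [_root_.cocompact_eq_atBot_atTop] at this
      exact this.mono_left le_sup_right
    rw [integral_Ioi_of_hasDerivAt_of_tendsto hFc.continuousWithinAt (fun z _ => hder z)
      hinteg.integrableOn ht, zero_sub]

lemma weakV_aux {K K' : ℝ → E2 → ℂ} {A A' : E2 → ℝ} (h : Sy K A) (h' : Sy K' A')
    (hA : MemLp A 2 (volume : Measure E2)) (hA' : MemLp A' 2 (volume : Measure E2))
    {φ : E3 → ℝ} (hφ : Tst φ) (S : Set ℝ) :
    (∫ x in {x : E3 | x 2 ∈ S}, TC K x * (fderiv ℝ φ x (stdb3 2) : ℝ))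
      + ∫ x in {x : E3 | x 2 ∈ S}, TC K' x * φ x
    = ∫ ξ, ∫ z in S, (K z ξ * Ph (fun x => fderiv ℝ φ x (stdb3 2)) z ξ + K' z ξ * Ph φ z ξ) := by
  have hd := hφ.deriv (stdb3 2)
  have i1 := pairK_int h hA hd S
  have i2 := pairK_int h' hA' hφ S
  rw [pair h hA hd S, pair h' hA' hφ S, ← integral_add i1.integral_prod_left i2.integral_prod_left]
  have e : ∫ z in S, (∫ ξ, K z ξ * Ph (fun x => fderiv ℝ φ x (stdb3 2)) z ξ)
      + ∫ ξ, K' z ξ * Ph φ z ξ = ∫ z in S, ∫ ξ, (K z ξ *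
        Ph (fun x => fderiv ℝ φ x (stdb3 2)) z ξ + K' z ξ * Ph φ z ξ) := by
    apply integral_congr_ae
    filter_upwards [i1.prod_right_ae, i2.prod_right_ae] with z h1 h2
    exact (integral_add h1 h2).symm
  rw [e]
  exact integral_integral_swap (i1.add i2)

lemma weakV {K K' : ℝ → E2 → ℂ} {A A' : E2 → ℝ} (h : Sy K A) (h' : Sy K' A')
    (hA : MemLp A 2 (volume : Measure E2)) (hA' : MemLp A' 2 (volume : Measure E2))
    (hK : ∀ z ξ, HasDerivAt (fun z => K z ξ) (K' z ξ) z)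
    {φ : E3 → ℝ} (hφ : Tst φ) :
    ∫ x in {x : E3 | x 2 ∈ (univ : Set ℝ)}, TC K x * (fderiv ℝ φ x (stdb3 2) : ℝ)
      = - ∫ x in {x : E3 | x 2 ∈ (univ : Set ℝ)}, TC K' x * φ x := by
  rw [eq_neg_iff_add_eq_zero, weakV_aux h h' hA hA' hφ]
  simp_rw [Measure.restrict_univ, (vert_core h h' hK hφ _).1]
  simp

lemma weakV_half {K K' : ℝ → E2 → ℂ} {A A' : E2 → ℝ} (h : Sy K A) (h' : Sy K' A')
    (hA : MemLp A 2 (volume : Measure E2)) (hA' : MemLp A' 2 (volume : Measure E2))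
    (hK : ∀ z ξ, HasDerivAt (fun z => K z ξ) (K' z ξ) z) {b : E2 → ℝ}
    (hb : MemLp b 2 (volume : Measure E2)) (h0 : ∀ ξ, K 0 ξ = FH (fun y => (b y : ℂ)) ξ)
    {φ : E3 → ℝ} (hφ : Tst φ) :
    (∫ x in {x : E3 | x 2 ∈ Ioi (0 : ℝ)}, TC K x * (fderiv ℝ φ x (stdb3 2) : ℝ))
      + ∫ x in {x : E3 | x 2 ∈ Ioi (0 : ℝ)}, TC K' x * φ x
      = - ∫ y, (b y : ℂ) * φ (embPlane y) := by
  rw [weakV_aux h h' hA hA' hφ]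
  simp_rw [(vert_core h h' hK hφ _).2, h0]
  rw [integral_neg]
  congr 1
  have := FH_pair (memLp_ofReal hb) (𝓕⁻ (hφ.sch 0))
  rw [FourierTransform.fourier_fourierInv_eq, SchwartzMap.fourierInv_coe, hφ.sch_coe] at this
  simp_rw [mul_comm (FH _ _)]
  refine this.trans ?_
  simp_rw [sl, jn_embPlane, mul_comm]


/-- real synthesis -/
def TR (K : ℝ → E2 → ℂ) (x : E3) : ℝ := (TC K x).re

lemma Sy.memLp_TR {K : ℝ → E2 → ℂ} {A : E2 → ℝ} (h : Sy K A)
    (hA : MemLp A 2 (volume : Measure E2)) : MemLp (TR K) 2 (volume : Measure E3) :=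
  (h.memLp_TC hA).re

lemma real_of_lint {α : Type*} [MeasurableSpace α] {μ : Measure α} {f : α → ℝ}
    (hf : AEStronglyMeasurable f μ) (h0 : ∀ x, 0 ≤ f x) {c B : ℝ≥0∞} (hc : c < ⊤) (hB : B < ⊤)
    (h : ∫⁻ x, ENNReal.ofReal (f x) ∂μ ≤ c * B) :
    Integrable f μ ∧ ∫ x, f x ∂μ ≤ c.toReal * B.toReal := by
  have hcB := ENNReal.mul_lt_top hc hB
  constructor
  · refine ⟨hf, ?_⟩
    rw [hasFiniteIntegral_iff_ofReal (Filter.Eventually.of_forall h0)]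
    exact h.trans_lt hcB
  · rw [integral_eq_lintegral_of_nonneg_ae (Filter.Eventually.of_forall h0) hf,
      ← ENNReal.toReal_mul]
    exact ENNReal.toReal_mono hcB.ne h

lemma re_sq_le (w : ℂ) : ENNReal.ofReal (w.re ^ 2) ≤ ‖w‖ₑ ^ 2 := by
  rw [← ofReal_norm, ← ENNReal.ofReal_pow (norm_nonneg _)]
  apply ENNReal.ofReal_le_ofReal
  rw [← sq_abs]
  have := Complex.abs_re_le_norm w
  gcongr

lemma A_toReal {A : E2 → ℝ} (hA : MemLp A 2 (volume : Measure E2)) :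
    (∫⁻ ξ, ENNReal.ofReal (A ξ ^ 2)).toReal = ∫ ξ, A ξ ^ 2 := by
  rw [integral_eq_lintegral_of_nonneg_ae (Filter.Eventually.of_forall fun x => sq_nonneg _)
    hA.integrable_sq.1]

lemma Sy.l2real {K : ℝ → E2 → ℂ} {A : E2 → ℝ} (h : Sy K A)
    (hA : MemLp A 2 (volume : Measure E2)) :
    Integrable (fun x => TR K x ^ 2) ∧ ∫ x, TR K x ^ 2 ≤ c0.toReal * ∫ ξ, A ξ ^ 2 := by
  rw [← A_toReal hA]
  refine real_of_lint (h.memLp_TR hA).integrable_sq.1 (fun x => sq_nonneg _) c0_lt (A_fin hA) ?_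
  exact (lintegral_mono fun x => re_sq_le _).trans (h.l2 hA)

lemma Sy.gagreal {K : ℝ → E2 → ℂ} {A : E2 → ℝ} (h : Sy K A)
    (hA : MemLp A 2 (volume : Measure E2)) :
    GagH12 (univ : Set E3) (TR K) ∧
      GagSqVal (univ : Set E3) (TR K) ≤ (2 * c0 * c1).toReal * ∫ ξ, A ξ ^ 2 := by
  rw [← A_toReal hA]
  unfold GagH12 GagSqVal
  rw [Measure.restrict_univ]
  have hT : Measurable (TR K) := Complex.measurable_re.comp (TC_meas h.meas)
  have hm : Measurable (fun q : E3 × E3 => (TR K q.1 - TR K q.2) ^ 2 / ‖q.1 - q.2‖ ^ (3 + 1)) := by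
    fun_prop
  refine real_of_lint hm.aestronglyMeasurable (fun x => by positivity)
    (ENNReal.mul_lt_top (ENNReal.mul_lt_top (by simp) c0_lt) c1_lt) (A_fin hA) ?_
  refine le_trans (lintegral_mono fun q => ?_) (h.gag hA)
  dsimp only
  rw [div_eq_inv_mul, ENNReal.ofReal_mul (by positivity)]
  unfold wt
  gcongr
  have := re_sq_le (TC K q.1 - TC K q.2)
  rwa [Complex.sub_re] at this

/-- horizontal multiplier -/
def hm (j : Fin 2) (K : ℝ → E2 → ℂ) (z : ℝ) (ξ : E2) : ℂ := (2 * π * Complex.I * (ξ j : ℂ)) * K z ξ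

/-- symbol of the derivative in direction `d`, `K'` being the vertical derivative of `K` -/
def Dd (d : Fin 3) (K K' : ℝ → E2 → ℂ) : ℝ → E2 → ℂ :=
  match d with
  | 0 => hm 0 K
  | 1 => hm 1 K
  | 2 => K'

lemma re_int {S : Set E3} {K : ℝ → E2 → ℂ} {A : E2 → ℝ} (h : Sy K A)
    (hA : MemLp A 2 (volume : Measure E2)) {φ : E3 → ℝ} (hφ : Tst φ) :
    Integrable (fun x => TR K x * φ x) (volume.restrict S) ∧
    ∫ x in S, TR K x * φ x = (∫ x in S, TC K x * φ x).re := by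
  have hi : Integrable (fun x => TC K x * φ x) (volume.restrict S) :=
    ((h.memLp_TC hA).integrable_mul hφ.memLp).restrict
  have e : ∀ x, TR K x * φ x = Complex.reCLM (TC K x * φ x) := by
    intro x; simp [TR]
  simp_rw [e]
  exact ⟨Complex.reCLM.integrable_comp hi, Complex.reCLM.integral_comp_comm hi⟩

lemma weakD {K K' : ℝ → E2 → ℂ} {A : E2 → ℝ} (hA : MemLp A 2 (volume : Measure E2))
    (h : Sy K A) (hD : ∀ d, Sy (Dd d K K') A)
    (hK : ∀ z ξ, HasDerivAt (fun z => K z ξ) (K' z ξ) z) (d : Fin 3) :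
    IsWeakD (univ : Set E3) (TR K) (TR (Dd d K K')) (EuclideanSpace.single d 1) := by
  intro φ hφ1 hφ2 _
  have hφ : Tst φ := ⟨hφ1, hφ2⟩
  rw [(re_int h hA (hφ.deriv _)).2, (re_int (hD d) hA hφ).2, ← Complex.neg_re]
  congr 1
  have hu : (univ : Set E3) = {x : E3 | x 2 ∈ (univ : Set ℝ)} := by simp
  rw [hu]
  fin_cases d
  · exact weakH h (hD 0) hA hA (d := 0) (fun _ _ => rfl) hφ univ
  · exact weakH h (hD 1) hA hA (d := 1) (fun _ _ => rfl) hφ univ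
  · exact weakV h (hD 2) hA hA hK hφ

lemma halfD {K K' : ℝ → E2 → ℂ} {A : E2 → ℝ} (hA : MemLp A 2 (volume : Measure E2))
    (h : Sy K A) (hD : ∀ d, Sy (Dd d K K') A)
    (hK : ∀ z ξ, HasDerivAt (fun z => K z ξ) (K' z ξ) z) {b : E2 → ℝ}
    (hb : MemLp b 2 (volume : Measure E2)) (h0 : ∀ ξ, K 0 ξ = FH (fun y => (b y : ℂ)) ξ) :
    HalfTrace3 (TR K) (fun d => TR (Dd d K K')) b := by
  intro φ hφ1 hφ2 d
  have hφ : Tst φ := ⟨hφ1, hφ2⟩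
  have r1 := re_int (S := {x : E3 | 0 < x 2}) h hA (hφ.deriv (stdb3 d))
  have r2 := re_int (S := {x : E3 | 0 < x 2}) (hD d) hA hφ
  rw [integral_add r1.1 r2.1, r1.2, r2.2, ← Complex.add_re]
  have hu : {x : E3 | 0 < x 2} = {x : E3 | x 2 ∈ Ioi (0 : ℝ)} := rfl
  rw [hu]
  fin_cases d
  · have := weakH h (hD 0) hA hA (d := 0) (fun _ _ => rfl) hφ (Ioi (0:ℝ))
    rw [eq_neg_iff_add_eq_zero] at this
    refine (congrArg Complex.re this).trans ?_
    simp
  · have := weakH h (hD 1) hA hA (d := 1) (fun _ _ => rfl) hφ (Ioi (0:ℝ))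
    rw [eq_neg_iff_add_eq_zero] at this
    refine (congrArg Complex.re this).trans ?_
    simp
  · have := weakV_half h (hD 2) hA hA hK hb h0 hφ
    refine (congrArg Complex.re this).trans ?_
    have e : ∫ y, (b y : ℂ) * φ (embPlane y) = ((∫ y, b y * φ (embPlane y) : ℝ) : ℂ) := by
      rw [← integral_complex_ofReal]; simp
    rw [e]
    simp

/-- symbols of order `-m` -/
structure SyO (K : ℝ → E2 → ℂ) (A : E2 → ℝ) (m : ℕ) : Prop where
  meas : Measurable (Function.uncurry K)
  bd : ∀ z ξ, ‖K z ξ‖ ≤ A ξ * ((sig ξ)^m)⁻¹ * (dz (sig ξ * z))^2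
  lip : ∀ z z' ξ, ‖K z ξ - K z' ξ‖ ≤ A ξ * ((sig ξ)^m)⁻¹ * (sig ξ * |z - z'|)

lemma SyO.A_nonneg {K : ℝ → E2 → ℂ} {A : E2 → ℝ} {m : ℕ} (h : SyO K A m) (ξ : E2) : 0 ≤ A ξ := by
  have := (norm_nonneg _).trans (h.bd 0 ξ)
  have hs := sig_pos ξ
  simp [dz] at this
  exact nonneg_of_mul_nonneg_left this (by positivity)

lemma SyO.sy {K : ℝ → E2 → ℂ} {A : E2 → ℝ} {m : ℕ} (h : SyO K A m) : Sy K A where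
  meas := h.meas
  bd z ξ := by
    refine (h.bd z ξ).trans ?_
    have := h.A_nonneg ξ
    have h1 : ((sig ξ)^m)⁻¹ ≤ 1 := inv_le_one_of_one_le₀ (one_le_pow₀ (sig_one ξ))
    gcongr
    nlinarith
  lip z z' ξ := by
    refine (h.lip z z' ξ).trans ?_
    have := h.A_nonneg ξ
    have hs := sig_pos ξ
    have h1 : ((sig ξ)^m)⁻¹ ≤ 1 := inv_le_one_of_one_le₀ (one_le_pow₀ (sig_one ξ))
    rw [← mul_assoc]
    gcongr
    nlinarith

lemma SyO.hm {K : ℝ → E2 → ℂ} {A : E2 → ℝ} {m : ℕ} (h : SyO K A (m+1)) (j : Fin 2) :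
    SyO (hm j K) A m where
  meas := by
    unfold _root_.hm Function.uncurry
    have h1 := h.meas
    have : Measurable (fun p : ℝ × E2 => K p.1 p.2) := h1
    fun_prop
  bd z ξ := by
    have hs := sig_pos ξ
    have := h.A_nonneg ξ
    unfold _root_.hm
    rw [norm_mul]
    calc _ ≤ sig ξ * (A ξ * ((sig ξ)^(m+1))⁻¹ * (dz (sig ξ * z))^2) :=
          mul_le_mul (xi_le j ξ) (h.bd z ξ) (norm_nonneg _) hs.le
      _ = _ := by field_simp; ring
  lip z z' ξ := by
    have hs := sig_pos ξ
    have := h.A_nonneg ξ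
    unfold _root_.hm
    rw [← mul_sub, norm_mul]
    calc _ ≤ sig ξ * (A ξ * ((sig ξ)^(m+1))⁻¹ * (sig ξ * |z - z'|)) :=
          mul_le_mul (xi_le j ξ) (h.lip z z' ξ) (norm_nonneg _) hs.le
      _ = _ := by field_simp; ring

lemma SyO.Dd {K K' : ℝ → E2 → ℂ} {A : E2 → ℝ} {m : ℕ} (h : SyO K A (m+1)) (h' : SyO K' A m)
    (d : Fin 3) : SyO (Dd d K K') A m := by
  fin_cases d
  · exact h.hm 0
  · exact h.hm 1
  · exact h'

lemma hm_deriv {K K' : ℝ → E2 → ℂ} (hK : ∀ z ξ, HasDerivAt (fun z => K z ξ) (K' z ξ) z)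
    (j : Fin 2) (z : ℝ) (ξ : E2) : HasDerivAt (fun z => hm j K z ξ) (hm j K' z ξ) z :=
  (hK z ξ).const_mul _

lemma Dd_deriv {K K' K'' : ℝ → E2 → ℂ} (hK : ∀ z ξ, HasDerivAt (fun z => K z ξ) (K' z ξ) z)
    (hK' : ∀ z ξ, HasDerivAt (fun z => K' z ξ) (K'' z ξ) z)
    (d : Fin 3) (z : ℝ) (ξ : E2) :
    HasDerivAt (fun z => Dd d K K' z ξ) (Dd d K' K'' z ξ) z := by
  fin_cases d
  · exact hm_deriv hK 0 z ξ
  · exact hm_deriv hK 1 z ξ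
  · exact hK' z ξ

def Cprof : ℝ := 13 * c0.toReal + 9 * (2 * c0 * c1).toReal

theorem profile {K K' K'' : ℝ → E2 → ℂ} {A : E2 → ℝ} (hA : MemLp A 2 (volume : Measure E2))
    (h0 : SyO K A 2) (h1 : SyO K' A 1) (h2 : SyO K'' A 0)
    (hK : ∀ z ξ, HasDerivAt (fun z => K z ξ) (K' z ξ) z)
    (hK' : ∀ z ξ, HasDerivAt (fun z => K' z ξ) (K'' z ξ) z) {b : E2 → ℝ}
    (hb : MemLp b 2 (volume : Measure E2)) (hb0 : ∀ ξ, K' 0 ξ = FH (fun y => (b y : ℂ)) ξ) :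
    ∃ G Hs, MemH2W (univ : Set E3) (TR K) G Hs ∧
          (∀ d d', GagH12 (univ : Set E3) (Hs d d')) ∧
          (∫ x : E3, ((TR K x) ^ 2 + ∑ d : Fin 3, (G d x) ^ 2 +
              ∑ d : Fin 3, ∑ d' : Fin 3, (Hs d d' x) ^ 2)) +
            (∑ d : Fin 3, ∑ d' : Fin 3, GagSqVal (univ : Set E3) (Hs d d'))
            ≤ Cprof * ∫ ξ, A ξ ^ 2 ∧
          HalfTrace3 (G 2) (fun d => Hs 2 d) b := by
  have sG : ∀ d, SyO (Dd d K K') A 1 := h0.Dd h1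
  have sG' : ∀ d, SyO (Dd d K' K'') A 0 := h1.Dd h2
  have dG := Dd_deriv hK hK'
  have sH : ∀ d d', SyO (Dd d' (Dd d K K') (Dd d K' K'')) A 0 := fun d => (sG d).Dd (sG' d)
  refine ⟨fun d => TR (Dd d K K'), fun d d' => TR (Dd d' (Dd d K K') (Dd d K' K'')),
    ⟨?_, fun d => ⟨?_, ?_⟩, fun d d' => ⟨?_, ?_⟩⟩, ?_, ?_, ?_⟩
  · unfold L2on
    rw [Measure.restrict_univ]
    exact h0.sy.memLp_TR hA
  · unfold L2on
    rw [Measure.restrict_univ]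
    exact (sG d).sy.memLp_TR hA
  · exact weakD hA h0.sy (fun d => (sG d).sy) hK d
  · unfold L2on
    rw [Measure.restrict_univ]
    exact (sH d d').sy.memLp_TR hA
  · exact weakD hA (sG d).sy (fun d' => (sH d d').sy) (dG d) d'
  · exact fun d d' => ((sH d d').sy.gagreal hA).1
  · have a0 := h0.sy.l2real hA
    have a1 := fun d => (sG d).sy.l2real hA
    have a2 := fun d d' => (sH d d').sy.l2real hA
    have a3 := fun d d' => ((sH d d').sy.gagreal hA).2
    have i1 : Integrable (fun x => ∑ d : Fin 3, TR (Dd d K K') x ^ 2) :=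
      integrable_finsetSum _ fun d _ => (a1 d).1
    have i2 : Integrable (fun x => ∑ d : Fin 3, ∑ d' : Fin 3,
        TR (Dd d' (Dd d K K') (Dd d K' K'')) x ^ 2) :=
      integrable_finsetSum _ fun d _ => integrable_finsetSum _ fun d' _ => (a2 d d').1
    have i3 : Integrable (fun x => TR K x ^ 2 + ∑ d : Fin 3, TR (Dd d K K') x ^ 2) := a0.1.add i1
    dsimp only
    rw [integral_add i3 i2, integral_add a0.1 i1,
      integral_finsetSum _ (fun d _ => (a1 d).1),
      integral_finsetSum _ (fun d _ => integrable_finsetSum _ fun d' _ => (a2 d d').1)]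
    simp_rw [fun d => integral_finsetSum Finset.univ (fun d' _ => (a2 d d').1)]
    have s1 : ∑ d : Fin 3, ∫ x, TR (Dd d K K') x ^ 2 ≤ ∑ d : Fin 3, (c0.toReal * ∫ ξ, A ξ ^ 2) :=
      Finset.sum_le_sum fun d _ => (a1 d).2
    have s2 : ∑ d : Fin 3, ∑ d' : Fin 3, ∫ x, TR (Dd d' (Dd d K K') (Dd d K' K'')) x ^ 2
        ≤ ∑ d : Fin 3, ∑ d' : Fin 3, (c0.toReal * ∫ ξ, A ξ ^ 2) :=
      Finset.sum_le_sum fun d _ => Finset.sum_le_sum fun d' _ => (a2 d d').2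
    have s3 : ∑ d : Fin 3, ∑ d' : Fin 3, GagSqVal univ (TR (Dd d' (Dd d K K') (Dd d K' K'')))
        ≤ ∑ d : Fin 3, ∑ d' : Fin 3, ((2 * c0 * c1).toReal * ∫ ξ, A ξ ^ 2) :=
      Finset.sum_le_sum fun d _ => Finset.sum_le_sum fun d' _ => a3 d d'
    simp only [Finset.sum_const, Finset.card_univ, Fintype.card_fin, nsmul_eq_mul] at s1 s2 s3
    have a02 := a0.2
    unfold Cprof
    push_cast at s1 s2 s3
    linarith
  · exact halfD hA (sG 2).sy (fun d' => (sH 2 d').sy) (dG 2) hb hb0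


/-- admissible parameters -/
structure Adm (t : ℂ × ℂ) : Prop where
  r0 : 0 ≤ t.1.re
  r1 : 0 ≤ t.2.re
  s : ‖t.1‖ + ‖t.2‖ = 1

def pP (t : ℂ) (τ : ℝ) : ℂ := (1 + τ * t)⁻¹
def wW (t : ℂ × ℂ) (τ : ℝ) : ℂ := pP t.1 τ * pP t.2 τ
def qQ (t : ℂ × ℂ) (τ : ℝ) : ℂ := t.1 * pP t.1 τ + t.2 * pP t.2 τ
def rR (t : ℂ × ℂ) (τ : ℝ) : ℂ := t.1 ^ 2 * pP t.1 τ ^ 2 + t.2 ^ 2 * pP t.2 τ ^ 2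
def sS (t : ℂ × ℂ) (τ : ℝ) : ℂ := t.1 ^ 3 * pP t.1 τ ^ 3 + t.2 ^ 3 * pP t.2 τ ^ 3
def m0 (t : ℂ × ℂ) (τ : ℝ) : ℂ := wW t τ ^ 5 * (6 - 5 * wW t τ)
def m1 (t : ℂ × ℂ) (τ : ℝ) : ℂ := wW t τ ^ 5 * (-30 * (qQ t τ * (1 - wW t τ)))
def m2 (t : ℂ × ℂ) (τ : ℝ) : ℂ :=
  wW t τ ^ 5 * (30 * (rR t τ * (1 - wW t τ) + qQ t τ ^ 2 * (5 - 6 * wW t τ)))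
def m3 (t : ℂ × ℂ) (τ : ℝ) : ℂ :=
  wW t τ ^ 5 * (-30 * (2 * (sS t τ * (1 - wW t τ)) + 3 * (qQ t τ * rR t τ * (5 - 6 * wW t τ))
    + qQ t τ ^ 3 * (25 - 36 * wW t τ)))
def n0 (t : ℂ × ℂ) (τ : ℝ) : ℂ := τ * m0 t τ
def n1 (t : ℂ × ℂ) (τ : ℝ) : ℂ := m0 t τ + τ * m1 t τ
def n2 (t : ℂ × ℂ) (τ : ℝ) : ℂ := 2 * m1 t τ + τ * m2 t τ
def n3 (t : ℂ × ℂ) (τ : ℝ) : ℂ := 3 * m2 t τ + τ * m3 t τ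

lemma pre_ge {t : ℂ} (ht : 0 ≤ t.re) {τ : ℝ} (hτ : 0 ≤ τ) : 1 ≤ ‖1 + τ * t‖ := by
  refine le_trans ?_ (Complex.re_le_norm _)
  simp
  positivity

lemma pne {t : ℂ} (ht : 0 ≤ t.re) {τ : ℝ} (hτ : 0 ≤ τ) : 1 + τ * t ≠ 0 := by
  rw [← norm_pos_iff]
  linarith [pre_ge ht hτ]

lemma pP_le {t : ℂ} (ht : 0 ≤ t.re) {τ : ℝ} (hτ : 0 ≤ τ) : ‖pP t τ‖ ≤ 1 := by
  unfold pP
  rw [norm_inv]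
  exact inv_le_one_of_one_le₀ (pre_ge ht hτ)

lemma pP_dec {t : ℂ} (ht : 0 ≤ t.re) {τ : ℝ} (hτ : 0 ≤ τ) :
    ‖pP t τ‖ ^ 2 * (1 + τ * ‖t‖) ^ 2 ≤ 2 := by
  unfold pP
  have h1 := pre_ge ht hτ
  rw [norm_inv, inv_pow, inv_mul_le_iff₀ (by positivity)]
  have e : ‖1 + τ * t‖ ^ 2 = 1 + 2 * τ * t.re + τ ^ 2 * ‖t‖ ^ 2 := by
    rw [← Complex.normSq_eq_norm_sq, ← Complex.normSq_eq_norm_sq, Complex.normSq_apply,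
      Complex.normSq_apply]
    simp
    ring
  rw [e]
  have : 0 ≤ τ * t.re := by positivity
  nlinarith [sq_nonneg (1 - τ * ‖t‖)]

lemma pP_deriv {t : ℂ} (ht : 0 ≤ t.re) {τ : ℝ} (hτ : 0 ≤ τ) :
    HasDerivAt (pP t) (-(t * pP t τ ^ 2)) τ := by
  have h : HasDerivAt (fun τ : ℝ => 1 + (τ : ℂ) * t) t τ := by
    have := ((hasDerivAt_id τ).ofReal_comp.mul_const t).const_add 1
    simpa using this
  have := h.inv (pne ht hτ)
  refine this.congr_deriv ?_
  unfold pP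
  rw [inv_pow]
  ring

section

lemma Adm.w_le {t : ℂ × ℂ} (h : Adm t) {τ : ℝ} (hτ : 0 ≤ τ) : ‖wW t τ‖ ≤ 1 := by
  unfold wW
  rw [norm_mul]
  exact mul_le_one₀ (pP_le h.r0 hτ) (norm_nonneg _) (pP_le h.r1 hτ)

lemma Adm.w_dec {t : ℂ × ℂ} (h : Adm t) {τ : ℝ} (hτ : 0 ≤ τ) : ‖wW t τ‖ * (1 + τ) ≤ 2 := by
  have h1 := pP_dec h.r0 hτ
  have h2 := pP_dec h.r1 hτ
  unfold wW
  rw [norm_mul]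
  have h3 : (‖pP t.1 τ‖ * ‖pP t.2 τ‖ * ((1 + τ * ‖t.1‖) * (1 + τ * ‖t.2‖))) ^ 2 ≤ 2 ^ 2 := by
    calc _ = (‖pP t.1 τ‖ ^ 2 * (1 + τ * ‖t.1‖) ^ 2) * (‖pP t.2 τ‖ ^ 2 * (1 + τ * ‖t.2‖) ^ 2) := by
          ring
      _ ≤ 2 * 2 := by gcongr
      _ = _ := by norm_num
  have h4 := abs_le_of_sq_le_sq h3 (by norm_num)
  refine le_trans ?_ ((le_abs_self _).trans h4)
  gcongr
  have : 0 ≤ τ * ‖t.1‖ * (τ * ‖t.2‖) := by positivity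
  have e : τ * ‖t.1‖ + τ * ‖t.2‖ = τ := by rw [← mul_add, h.s, mul_one]
  nlinarith

lemma Adm.t_le {t : ℂ × ℂ} (h : Adm t) {τ : ℝ} (hτ : 0 ≤ τ) : ‖t.1‖ ≤ 1 ∧ ‖t.2‖ ≤ 1 := by
  have := h.s
  constructor <;> linarith [norm_nonneg t.1, norm_nonneg t.2]

lemma Adm.k_le {t : ℂ × ℂ} (h : Adm t) {τ : ℝ} (hτ : 0 ≤ τ) (k : ℕ) : ‖t.1 ^ (k+1) * pP t.1 τ ^ (k+1) + t.2 ^ (k+1) * pP t.2 τ ^ (k+1)‖ ≤ 1 := by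
  have h1 := pP_le h.r0 hτ
  have h2 := pP_le h.r1 hτ
  have h3 := h.t_le hτ
  rw [← h.s]
  refine norm_add_le_of_le ?_ ?_
  · rw [norm_mul, norm_pow, norm_pow, pow_succ]
    have a : ‖t.1‖ ^ k ≤ 1 := pow_le_one₀ (norm_nonneg _) h3.1
    have b : ‖pP t.1 τ‖ ^ (k+1) ≤ 1 := pow_le_one₀ (norm_nonneg _) h1
    calc _ ≤ 1 * ‖t.1‖ * 1 := by gcongr
      _ = _ := by ring
  · rw [norm_mul, norm_pow, norm_pow, pow_succ]
    have a : ‖t.2‖ ^ k ≤ 1 := pow_le_one₀ (norm_nonneg _) h3.2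
    have b : ‖pP t.2 τ‖ ^ (k+1) ≤ 1 := pow_le_one₀ (norm_nonneg _) h2
    calc _ ≤ 1 * ‖t.2‖ * 1 := by gcongr
      _ = _ := by ring

lemma Adm.q_le {t : ℂ × ℂ} (h : Adm t) {τ : ℝ} (hτ : 0 ≤ τ) : ‖qQ t τ‖ ≤ 1 := by simpa [qQ] using h.k_le hτ 0
lemma Adm.r_le {t : ℂ × ℂ} (h : Adm t) {τ : ℝ} (hτ : 0 ≤ τ) : ‖rR t τ‖ ≤ 1 := by simpa [rR] using h.k_le hτ 1
lemma Adm.s_le {t : ℂ × ℂ} (h : Adm t) {τ : ℝ} (hτ : 0 ≤ τ) : ‖sS t τ‖ ≤ 1 := by simpa [sS] using h.k_le hτ 2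

lemma Adm.wd {t : ℂ × ℂ} (h : Adm t) {τ : ℝ} (hτ : 0 ≤ τ) : HasDerivAt (wW t) (-(qQ t τ * wW t τ)) τ := by
  have := (pP_deriv h.r0 hτ).mul (pP_deriv h.r1 hτ)
  refine this.congr_deriv ?_
  unfold qQ wW
  ring

lemma Adm.qd {t : ℂ × ℂ} (h : Adm t) {τ : ℝ} (hτ : 0 ≤ τ) : HasDerivAt (qQ t) (-(rR t τ)) τ := by
  have := ((pP_deriv h.r0 hτ).const_mul t.1).add ((pP_deriv h.r1 hτ).const_mul t.2)
  refine this.congr_deriv ?_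
  unfold rR
  ring

lemma Adm.rd {t : ℂ × ℂ} (h : Adm t) {τ : ℝ} (hτ : 0 ≤ τ) : HasDerivAt (rR t) (-(2 * sS t τ)) τ := by
  have := (((pP_deriv h.r0 hτ).pow 2).const_mul (t.1 ^ 2)).add
    (((pP_deriv h.r1 hτ).pow 2).const_mul (t.2 ^ 2))
  refine this.congr_deriv ?_
  unfold sS
  simp
  ring

lemma Adm.m0d {t : ℂ × ℂ} (h : Adm t) {τ : ℝ} (hτ : 0 ≤ τ) : HasDerivAt (m0 t) (m1 t τ) τ := by
  have w := h.wd hτ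
  have := (w.pow 5).mul ((w.const_mul 5).const_sub 6)
  refine this.congr_deriv ?_
  unfold m1
  simp
  ring

lemma Adm.m1d {t : ℂ × ℂ} (h : Adm t) {τ : ℝ} (hτ : 0 ≤ τ) : HasDerivAt (m1 t) (m2 t τ) τ := by
  have w := h.wd hτ
  have := (w.pow 5).mul (((h.qd hτ).mul (w.const_sub 1)).const_mul (-30))
  refine this.congr_deriv ?_
  unfold m2
  simp
  ring

lemma Adm.m2d {t : ℂ × ℂ} (h : Adm t) {τ : ℝ} (hτ : 0 ≤ τ) : HasDerivAt (m2 t) (m3 t τ) τ := by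
  have w := h.wd hτ
  have := (w.pow 5).mul ((((h.rd hτ).mul (w.const_sub 1)).add
    (((h.qd hτ).pow 2).mul ((w.const_mul 6).const_sub 5))).const_mul 30)
  refine this.congr_deriv ?_
  unfold m3
  simp
  ring

lemma td (τ : ℝ) : HasDerivAt (fun τ : ℝ => (τ : ℂ)) 1 τ := by
  simpa using (hasDerivAt_id τ).ofReal_comp

lemma Adm.n0d {t : ℂ × ℂ} (h : Adm t) {τ : ℝ} (hτ : 0 ≤ τ) : HasDerivAt (n0 t) (n1 t τ) τ := by
  have := (td τ).mul (h.m0d hτ)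
  refine this.congr_deriv ?_
  unfold n1
  ring

lemma Adm.n1d {t : ℂ × ℂ} (h : Adm t) {τ : ℝ} (hτ : 0 ≤ τ) : HasDerivAt (n1 t) (n2 t τ) τ := by
  have := (h.m0d hτ).add ((td τ).mul (h.m1d hτ))
  refine this.congr_deriv ?_
  unfold n2
  ring

lemma Adm.n2d {t : ℂ × ℂ} (h : Adm t) {τ : ℝ} (hτ : 0 ≤ τ) : HasDerivAt (n2 t) (n3 t τ) τ := by
  have := ((h.m1d hτ).const_mul 2).add ((td τ).mul (h.m2d hτ))
  refine this.congr_deriv ?_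
  unfold n3
  ring

lemma nm {a b : ℂ} {A B : ℝ} (ha : ‖a‖ ≤ A) (hb : ‖b‖ ≤ B) : ‖a * b‖ ≤ A * B := by
  rw [norm_mul]
  exact mul_le_mul ha hb (norm_nonneg _) ((norm_nonneg _).trans ha)

lemma nsb {a b : ℂ} {A B : ℝ} (ha : ‖a‖ ≤ A) (hb : ‖b‖ ≤ B) : ‖a - b‖ ≤ A + B :=
  norm_sub_le_of_le ha hb

lemma npw {a : ℂ} (ha : ‖a‖ ≤ 1) (k : ℕ) : ‖a ^ k‖ ≤ 1 := by
  rw [norm_pow]; exact pow_le_one₀ (norm_nonneg _) ha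

lemma nnum (k : ℕ) [k.AtLeastTwo] : ‖(OfNat.ofNat k : ℂ)‖ ≤ OfNat.ofNat k := by simp

lemma n30 : ‖(-30 : ℂ)‖ ≤ 30 := by simp

lemma Adm.w5 {t : ℂ × ℂ} (h : Adm t) {τ : ℝ} (hτ : 0 ≤ τ) : ‖wW t τ ^ 5‖ ≤ ‖wW t τ‖ ^ 4 * 1 := by
  rw [norm_pow, pow_succ]
  gcongr
  exact h.w_le hτ

lemma Adm.tw5 {t : ℂ × ℂ} (h : Adm t) {τ : ℝ} (hτ : 0 ≤ τ) : ‖τ * wW t τ ^ 5‖ ≤ ‖wW t τ‖ ^ 4 * 2 := by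
  rw [norm_mul, norm_pow, pow_succ, Complex.norm_real, Real.norm_of_nonneg hτ]
  have := h.w_dec hτ
  have h3 : 0 ≤ ‖wW t τ‖ := norm_nonneg _
  calc _ = ‖wW t τ‖ ^ 4 * (‖wW t τ‖ * τ) := by ring
    _ ≤ _ := by gcongr; linarith

lemma Adm.mb0 {t : ℂ × ℂ} (h : Adm t) {τ : ℝ} (hτ : 0 ≤ τ) : ‖6 - 5 * wW t τ‖ ≤ 11 :=
  (nsb (nnum 6) (nm (nnum 5) (h.w_le hτ))).trans (by norm_num)
lemma Adm.mb1 {t : ℂ × ℂ} (h : Adm t) {τ : ℝ} (hτ : 0 ≤ τ) : ‖-30 * (qQ t τ * (1 - wW t τ))‖ ≤ 60 :=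
  (nm n30 (nm (h.q_le hτ) (nsb norm_one.le (h.w_le hτ)))).trans (by norm_num)
lemma Adm.mb2 {t : ℂ × ℂ} (h : Adm t) {τ : ℝ} (hτ : 0 ≤ τ) : ‖30 * (rR t τ * (1 - wW t τ) + qQ t τ ^ 2 * (5 - 6 * wW t τ))‖ ≤ 390 :=
  (nm (nnum 30) (norm_add_le_of_le (nm (h.r_le hτ) (nsb norm_one.le (h.w_le hτ)))
    (nm (npw (h.q_le hτ) 2) (nsb (nnum 5) (nm (nnum 6) (h.w_le hτ)))))).trans (by norm_num)
lemma Adm.mb3 {t : ℂ × ℂ} (h : Adm t) {τ : ℝ} (hτ : 0 ≤ τ) : ‖-30 * (2 * (sS t τ * (1 - wW t τ)) + 3 * (qQ t τ * rR t τ * (5 - 6 * wW t τ))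
    + qQ t τ ^ 3 * (25 - 36 * wW t τ))‖ ≤ 2940 :=
  (nm n30 (norm_add_le_of_le (norm_add_le_of_le
      (nm (nnum 2) (nm (h.s_le hτ) (nsb norm_one.le (h.w_le hτ))))
      (nm (nnum 3) (nm (nm (h.q_le hτ) (h.r_le hτ)) (nsb (nnum 5) (nm (nnum 6) (h.w_le hτ))))))
    (nm (npw (h.q_le hτ) 3) (nsb (nnum 25) (nm (nnum 36) (h.w_le hτ)))))).trans (by norm_num)

lemma Adm.w4 {t : ℂ × ℂ} (h : Adm t) {τ : ℝ} (hτ : 0 ≤ τ) : ‖wW t τ‖ ^ 4 ≤ 16 * (dz τ) ^ 2 := by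
  have h1 := h.w_dec hτ
  have h2 : ‖wW t τ‖ ≤ 2 * (1 + τ)⁻¹ := by
    rw [← div_eq_mul_inv, le_div_iff₀ (by positivity)]; exact h1
  unfold dz
  rw [abs_of_nonneg hτ, ← inv_pow]
  calc _ ≤ (2 * (1 + τ)⁻¹) ^ 4 := by gcongr
    _ = _ := by ring

lemma Adm.fin {t : ℂ × ℂ} (h : Adm t) {τ : ℝ} (hτ : 0 ≤ τ) {f : ℂ} {c : ℝ} (hf : ‖f‖ ≤ ‖wW t τ‖ ^ 4 * c) (hc : c ≤ 8000) :
    ‖f‖ ≤ 128000 * (dz τ) ^ 2 := by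
  have := h.w4 hτ
  have h4 : 0 ≤ ‖wW t τ‖ ^ 4 := by positivity
  calc _ ≤ ‖wW t τ‖ ^ 4 * c := hf
    _ ≤ ‖wW t τ‖ ^ 4 * 8000 := by gcongr
    _ ≤ (16 * (dz τ) ^ 2) * 8000 := by gcongr
    _ = _ := by ring

lemma Adm.m0b {t : ℂ × ℂ} (h : Adm t) {τ : ℝ} (hτ : 0 ≤ τ) : ‖m0 t τ‖ ≤ 128000 * (dz τ) ^ 2 :=
  h.fin hτ ((nm (h.w5 hτ) (h.mb0 hτ)).trans_eq (mul_assoc _ _ _)) (by norm_num)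
lemma Adm.m1b {t : ℂ × ℂ} (h : Adm t) {τ : ℝ} (hτ : 0 ≤ τ) : ‖m1 t τ‖ ≤ 128000 * (dz τ) ^ 2 :=
  h.fin hτ ((nm (h.w5 hτ) (h.mb1 hτ)).trans_eq (mul_assoc _ _ _)) (by norm_num)
lemma Adm.m2b {t : ℂ × ℂ} (h : Adm t) {τ : ℝ} (hτ : 0 ≤ τ) : ‖m2 t τ‖ ≤ 128000 * (dz τ) ^ 2 :=
  h.fin hτ ((nm (h.w5 hτ) (h.mb2 hτ)).trans_eq (mul_assoc _ _ _)) (by norm_num)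
lemma Adm.m3b {t : ℂ × ℂ} (h : Adm t) {τ : ℝ} (hτ : 0 ≤ τ) : ‖m3 t τ‖ ≤ 128000 * (dz τ) ^ 2 :=
  h.fin hτ ((nm (h.w5 hτ) (h.mb3 hτ)).trans_eq (mul_assoc _ _ _)) (by norm_num)
lemma Adm.n0b {t : ℂ × ℂ} (h : Adm t) {τ : ℝ} (hτ : 0 ≤ τ) : ‖n0 t τ‖ ≤ 128000 * (dz τ) ^ 2 := by
  unfold n0 m0
  rw [← mul_assoc]
  exact h.fin hτ ((nm (h.tw5 hτ) (h.mb0 hτ)).trans_eq (mul_assoc _ _ _)) (by norm_num)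
lemma Adm.n1b {t : ℂ × ℂ} (h : Adm t) {τ : ℝ} (hτ : 0 ≤ τ) : ‖n1 t τ‖ ≤ 128000 * (dz τ) ^ 2 := by
  unfold n1 m0 m1
  rw [← mul_assoc (τ : ℂ)]
  refine h.fin hτ (c := 1 * 11 + 2 * 60) ?_ (by norm_num)
  rw [mul_add, ← mul_assoc (‖wW t τ‖ ^ 4), ← mul_assoc (‖wW t τ‖ ^ 4)]
  exact norm_add_le_of_le (nm (h.w5 hτ) (h.mb0 hτ)) (nm (h.tw5 hτ) (h.mb1 hτ))
lemma Adm.n2b {t : ℂ × ℂ} (h : Adm t) {τ : ℝ} (hτ : 0 ≤ τ) : ‖n2 t τ‖ ≤ 128000 * (dz τ) ^ 2 := by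
  unfold n2 m1 m2
  rw [← mul_assoc (τ : ℂ)]
  refine h.fin hτ (c := 2 * 60 + 2 * 390) ?_ (by norm_num)
  refine (norm_add_le_of_le (nm (nnum 2) (nm (h.w5 hτ) (h.mb1 hτ)))
    (nm (h.tw5 hτ) (h.mb2 hτ))).trans_eq ?_
  norm_num; ring
lemma Adm.n3b {t : ℂ × ℂ} (h : Adm t) {τ : ℝ} (hτ : 0 ≤ τ) : ‖n3 t τ‖ ≤ 128000 * (dz τ) ^ 2 := by
  unfold n3 m2 m3
  rw [← mul_assoc (τ : ℂ)]
  refine h.fin hτ (c := 3 * 390 + 2 * 2940) ?_ (by norm_num)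
  refine (norm_add_le_of_le (nm (nnum 3) (nm (h.w5 hτ) (h.mb2 hτ)))
    (nm (h.tw5 hτ) (h.mb3 hτ))).trans_eq ?_
  norm_num; ring
end

lemma wW_zero (t : ℂ × ℂ) : wW t 0 = 1 := by simp [wW, pP]
lemma m0_zero (t : ℂ × ℂ) : m0 t 0 = 1 := by simp [m0, wW_zero]; norm_num
lemma m1_zero (t : ℂ × ℂ) : m1 t 0 = 0 := by simp [m1, wW_zero]
lemma n0_zero (t : ℂ × ℂ) : n0 t 0 = 0 := by simp [n0]
lemma n1_zero (t : ℂ × ℂ) : n1 t 0 = 1 := by simp [n1, m0_zero]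
lemma n2_zero (t : ℂ × ℂ) : n2 t 0 = 0 := by simp [n2, m1_zero]

/-- extension from the half line -/
def Ex (ε : ℂ) (f : ℝ → ℂ) (τ : ℝ) : ℂ := if 0 ≤ τ then f τ else ε * f (-τ)

lemma Ex_neg {ε : ℂ} {f : ℝ → ℂ} (h0 : f 0 = ε * f 0) {τ : ℝ} (h : τ ≤ 0) :
    Ex ε f τ = ε * f (-τ) := by
  unfold Ex
  split_ifs with h1
  · have : τ = 0 := le_antisymm h h1
    subst this; simpa using h0
  · rfl

lemma Ex_deriv {ε : ℂ} {f f' : ℝ → ℂ} (h0 : f 0 = ε * f 0) (h1 : f' 0 = -ε * f' 0)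
    (hd : ∀ τ, 0 ≤ τ → HasDerivAt f (f' τ) τ) (τ : ℝ) :
    HasDerivAt (Ex ε f) (Ex (-ε) f' τ) τ := by
  have right : ∀ τ, 0 ≤ τ → HasDerivWithinAt (Ex ε f) (Ex (-ε) f' τ) (Ici 0) τ := by
    intro τ hτ
    have := (hd τ hτ).hasDerivWithinAt (s := Ici 0)
    rw [show Ex (-ε) f' τ = f' τ by simp [Ex, hτ]]
    exact this.congr (fun x hx => by simp [Ex, mem_Ici.1 hx]) (by simp [Ex, hτ])
  have left : ∀ τ, τ ≤ 0 → HasDerivWithinAt (Ex ε f) (Ex (-ε) f' τ) (Iic 0) τ := by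
    intro τ hτ
    have h2 : HasDerivAt (fun τ => ε * f (-τ)) (-ε * f' (-τ)) τ := by
      have := ((hd (-τ) (by linarith)).scomp τ (hasDerivAt_neg τ)).const_mul ε
      refine this.congr_deriv ?_
      simp
    rw [Ex_neg h1 hτ]
    exact h2.hasDerivWithinAt.congr (fun x hx => Ex_neg h0 hx) (Ex_neg h0 hτ)
  rcases lt_trichotomy τ 0 with h | h | h
  · exact (left τ h.le).hasDerivAt (Iic_mem_nhds h)
  · subst h
    have := (left 0 le_rfl).union (right 0 le_rfl)
    rw [Iic_union_Ici] at this
    exact hasDerivWithinAt_univ.1 this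
  · exact (right τ h.le).hasDerivAt (Ici_mem_nhds h)

lemma dz_neg (t : ℝ) : dz (-t) = dz t := by simp [dz]

lemma Ex_bd {ε : ℂ} (hε : ‖ε‖ = 1) {f : ℝ → ℂ} {c : ℝ} (hf : ∀ τ, 0 ≤ τ → ‖f τ‖ ≤ c * (dz τ)^2)
    (τ : ℝ) : ‖Ex ε f τ‖ ≤ c * (dz τ)^2 := by
  unfold Ex
  split_ifs with h
  · exact hf τ h
  · rw [norm_mul, hε, one_mul, ← dz_neg τ]
    exact hf _ (by linarith)

lemma Ex_lip {ε : ℂ} (hε : ‖ε‖ = 1) {f f' : ℝ → ℂ} {c : ℝ} (hc : 0 ≤ c) (h0 : f 0 = ε * f 0)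
    (hd : ∀ τ, 0 ≤ τ → HasDerivAt f (f' τ) τ) (hf : ∀ τ, 0 ≤ τ → ‖f' τ‖ ≤ c * (dz τ)^2)
    (τ τ' : ℝ) : ‖Ex ε f τ - Ex ε f τ'‖ ≤ c * |τ - τ'| := by
  have key : ∀ a b, 0 ≤ a → 0 ≤ b → ‖f a - f b‖ ≤ c * |a - b| := by
    intro a b ha hb
    have := (convex_Ici (0:ℝ)).norm_image_sub_le_of_norm_hasDerivWithin_le (C := c)
      (fun x hx => (hd x hx).hasDerivWithinAt) (fun x hx => (hf x hx).trans ?_) hb ha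
    · simpa using this
    · have h1 := dz_le_one x
      have h2 := dz_nonneg x
      have : (dz x)^2 ≤ 1 := pow_le_one₀ h2 h1
      nlinarith
  have pos : ∀ a, 0 ≤ a → Ex ε f a = f a := fun a ha => by simp [Ex, ha]
  have mixed : ∀ a b, 0 ≤ a → b ≤ 0 → ‖Ex ε f a - Ex ε f b‖ ≤ c * |a - b| := by
    intro a b ha hb
    rw [pos a ha, Ex_neg h0 hb]
    have e : f a - ε * f (-b) = (f a - f 0) + ε * (f 0 - f (-b)) := by
      linear_combination h0
    rw [e]
    have k1 := key a 0 ha le_rfl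
    have k2 := key 0 (-b) le_rfl (by linarith)
    have k3 : ‖ε * (f 0 - f (-b))‖ ≤ c * |0 - -b| := by rw [norm_mul, hε, one_mul]; exact k2
    refine (norm_add_le_of_le k1 k3).trans_eq ?_
    rw [← mul_add, abs_of_nonneg (by linarith), abs_of_nonpos (by linarith), abs_of_nonneg (by linarith)]
    ring
  rcases le_total 0 τ with h | h <;> rcases le_total 0 τ' with h' | h'
  · rw [pos _ h, pos _ h']; exact key _ _ h h'
  · exact mixed _ _ h h'
  · rw [norm_sub_rev, abs_sub_comm]; exact mixed _ _ h' h
  · rw [Ex_neg h0 h, Ex_neg h0 h', ← mul_sub, norm_mul, hε, one_mul]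
    refine (key _ _ (by linarith) (by linarith)).trans_eq ?_
    rw [← abs_neg]; congr 2; ring


def tt (ξ : E2) : ℂ × ℂ := (sj 0 ξ / (sig ξ : ℂ), sj 1 ξ / (sig ξ : ℂ))

lemma tt_adm (ξ : E2) : Adm (tt ξ) := by
  have hs := sig_pos ξ
  refine ⟨?_, ?_, ?_⟩
  · simp only [tt, Complex.div_ofReal_re, sj_re]; positivity
  · simp only [tt, Complex.div_ofReal_re, sj_re]; positivity
  · simp only [tt, norm_div, Complex.norm_real, Real.norm_of_nonneg hs.le]
    rw [← add_div]
    exact div_self hs.ne'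

lemma tt_meas : Measurable tt := by
  unfold tt
  have := (sj_cont 0).measurable
  have := (sj_cont 1).measurable
  have := sig_cont.measurable
  fun_prop

/-- general symbol -/
def KG (i : ℕ) (a b : E2 → ℂ) (X Y : ℂ × ℂ → ℝ → ℂ) (z : ℝ) (ξ : E2) : ℂ :=
  (sig ξ : ℂ) ^ i * (a ξ * X (tt ξ) (sig ξ * z) + b ξ * (sig ξ : ℂ)⁻¹ * Y (tt ξ) (sig ξ * z))

def AA (a b : E2 → ℂ) (ξ : E2) : ℝ := 128000 * (sig ξ ^ 2 * ‖a ξ‖ + sig ξ * ‖b ξ‖)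

lemma KG_syo {i m : ℕ} (him : i + m = 2) {a b : E2 → ℂ} (ha : Measurable a) (hb : Measurable b)
    {X Y : ℂ × ℂ → ℝ → ℂ} (mX : Measurable (Function.uncurry X))
    (mY : Measurable (Function.uncurry Y))
    (bX : ∀ t, Adm t → ∀ τ, ‖X t τ‖ ≤ 128000 * (dz τ)^2)
    (bY : ∀ t, Adm t → ∀ τ, ‖Y t τ‖ ≤ 128000 * (dz τ)^2)
    (lX : ∀ t, Adm t → ∀ τ τ', ‖X t τ - X t τ'‖ ≤ 128000 * |τ - τ'|)
    (lY : ∀ t, Adm t → ∀ τ τ', ‖Y t τ - Y t τ'‖ ≤ 128000 * |τ - τ'|) :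
    SyO (KG i a b X Y) (AA a b) m where
  meas := by
    unfold KG Function.uncurry
    have h1 := tt_meas
    have h2 := sig_cont.measurable
    have h3 : Measurable (fun p : ℝ × E2 => X (tt p.2) (sig p.2 * p.1)) :=
      mX.comp (g := Function.uncurry X) (f := fun p : ℝ × E2 => (tt p.2, sig p.2 * p.1)) (by fun_prop)
    have h4 : Measurable (fun p : ℝ × E2 => Y (tt p.2) (sig p.2 * p.1)) :=
      mY.comp (g := Function.uncurry Y) (f := fun p : ℝ × E2 => (tt p.2, sig p.2 * p.1)) (by fun_prop)
    fun_prop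
  bd z ξ := by
    have hs := sig_pos ξ
    unfold KG
    rw [norm_mul, norm_pow, Complex.norm_real, Real.norm_of_nonneg hs.le]
    have h1 : ‖a ξ * X (tt ξ) (sig ξ * z) + b ξ * (sig ξ : ℂ)⁻¹ * Y (tt ξ) (sig ξ * z)‖ ≤
        ‖a ξ‖ * (128000 * (dz (sig ξ * z))^2) +
          (‖b ξ‖ * (sig ξ)⁻¹) * (128000 * (dz (sig ξ * z))^2) := by
      refine norm_add_le_of_le (nm le_rfl (bX _ (tt_adm ξ) _)) (nm ?_ (bY _ (tt_adm ξ) _))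
      rw [norm_mul, norm_inv, Complex.norm_real, Real.norm_of_nonneg hs.le]
    refine (mul_le_mul_of_nonneg_left h1 (by positivity)).trans_eq ?_
    calc _ = _ := rfl
      _ = _ := by
        unfold AA
        have : sig ξ ^ 2 = sig ξ ^ i * sig ξ ^ m := by rw [← pow_add, him]
        have e : sig ξ ^ i = sig ξ ^ 2 * (sig ξ ^ m)⁻¹ := by rw [this]; field_simp
        rw [e]
        field_simp
  lip z z' ξ := by
    have hs := sig_pos ξ
    unfold KG
    have e0 : sig ξ * |z - z'| = |sig ξ * z - sig ξ * z'| := by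
      rw [← mul_sub, abs_mul, abs_of_pos hs]
    rw [e0]
    set D := |sig ξ * z - sig ξ * z'|
    have e1 : ∀ s a b x y x' y' : ℂ, s * (a * x + b * y) - s * (a * x' + b * y') =
      s * (a * (x - x') + b * (y - y')) := by intros; ring
    rw [e1, norm_mul, norm_pow, Complex.norm_real, Real.norm_of_nonneg hs.le]
    have h1 : ‖a ξ * (X (tt ξ) (sig ξ * z) - X (tt ξ) (sig ξ * z')) +
        b ξ * (sig ξ : ℂ)⁻¹ * (Y (tt ξ) (sig ξ * z) - Y (tt ξ) (sig ξ * z'))‖ ≤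
        ‖a ξ‖ * (128000 * D) + (‖b ξ‖ * (sig ξ)⁻¹) * (128000 * D) := by
      refine norm_add_le_of_le (nm le_rfl (lX _ (tt_adm ξ) _ _)) (nm ?_ (lY _ (tt_adm ξ) _ _))
      rw [norm_mul, norm_inv, Complex.norm_real, Real.norm_of_nonneg hs.le]
    refine (mul_le_mul_of_nonneg_left h1 (by positivity)).trans_eq ?_
    calc _ = _ := rfl
      _ = _ := by
        unfold AA
        have : sig ξ ^ 2 = sig ξ ^ i * sig ξ ^ m := by rw [← pow_add, him]
        have e : sig ξ ^ i = sig ξ ^ 2 * (sig ξ ^ m)⁻¹ := by rw [this]; field_simp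
        rw [e]
        field_simp

def EX (ε : ℂ) (f : ℂ × ℂ → ℝ → ℂ) (t : ℂ × ℂ) (τ : ℝ) : ℂ := Ex ε (f t) τ

lemma EX_meas (ε : ℂ) {f : ℂ × ℂ → ℝ → ℂ} (hf : Measurable (Function.uncurry f)) :
    Measurable (Function.uncurry (EX ε f)) := by
  unfold EX Ex
  have h1 : Measurable fun p : (ℂ × ℂ) × ℝ => ε * f p.1 (-p.2) :=
    (hf.comp (g := Function.uncurry f) (f := fun p : (ℂ × ℂ) × ℝ => (p.1, -p.2))
      (by fun_prop)).const_mul ε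
  exact Measurable.ite (measurableSet_le measurable_const measurable_snd) hf h1

lemma w_meas : Measurable (fun p : (ℂ × ℂ) × ℝ => wW p.1 p.2) := by unfold wW pP; fun_prop
lemma q_meas : Measurable (fun p : (ℂ × ℂ) × ℝ => qQ p.1 p.2) := by unfold qQ pP; fun_prop
lemma r_meas : Measurable (fun p : (ℂ × ℂ) × ℝ => rR p.1 p.2) := by unfold rR pP; fun_prop
lemma m0_meas : Measurable (fun p : (ℂ × ℂ) × ℝ => m0 p.1 p.2) := by
  unfold m0; have := w_meas; fun_prop
lemma m1_meas : Measurable (fun p : (ℂ × ℂ) × ℝ => m1 p.1 p.2) := by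
  unfold m1; have := w_meas; have := q_meas; fun_prop
lemma m2_meas : Measurable (fun p : (ℂ × ℂ) × ℝ => m2 p.1 p.2) := by
  unfold m2; have := w_meas; have := q_meas; have := r_meas; fun_prop
lemma n0_meas : Measurable (fun p : (ℂ × ℂ) × ℝ => n0 p.1 p.2) := by
  unfold n0; have := m0_meas; fun_prop
lemma n1_meas : Measurable (fun p : (ℂ × ℂ) × ℝ => n1 p.1 p.2) := by
  unfold n1; have := m0_meas; have := m1_meas; fun_prop
lemma n2_meas : Measurable (fun p : (ℂ × ℂ) × ℝ => n2 p.1 p.2) := by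
  unfold n2; have := m1_meas; have := m2_meas; fun_prop

def K0 (a b : E2 → ℂ) := KG 0 a b (EX 1 m0) (EX (-1) n0)
def K1 (a b : E2 → ℂ) := KG 1 a b (EX (-1) m1) (EX 1 n1)
def K2 (a b : E2 → ℂ) := KG 2 a b (EX 1 m2) (EX (-1) n2)

lemma K0_syo {a b : E2 → ℂ} (ha : Measurable a) (hb : Measurable b) : SyO (K0 a b) (AA a b) 2 := by
  refine KG_syo (by norm_num) ha hb (EX_meas _ m0_meas) (EX_meas _ n0_meas) ?_ ?_ ?_ ?_
  · exact fun t h τ => Ex_bd (by simp) (fun τ hτ => h.m0b hτ) τ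
  · exact fun t h τ => Ex_bd (by simp) (fun τ hτ => h.n0b hτ) τ
  · exact fun t h τ τ' => Ex_lip (by simp) (by norm_num) (by simp)
      (fun τ hτ => h.m0d hτ) (fun τ hτ => h.m1b hτ) τ τ'
  · exact fun t h τ τ' => Ex_lip (by simp) (by norm_num) (by simp [n0_zero])
      (fun τ hτ => h.n0d hτ) (fun τ hτ => h.n1b hτ) τ τ'

lemma K1_syo {a b : E2 → ℂ} (ha : Measurable a) (hb : Measurable b) : SyO (K1 a b) (AA a b) 1 := by
  refine KG_syo (by norm_num) ha hb (EX_meas _ m1_meas) (EX_meas _ n1_meas) ?_ ?_ ?_ ?_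
  · exact fun t h τ => Ex_bd (by simp) (fun τ hτ => h.m1b hτ) τ
  · exact fun t h τ => Ex_bd (by simp) (fun τ hτ => h.n1b hτ) τ
  · exact fun t h τ τ' => Ex_lip (by simp) (by norm_num) (by simp [m1_zero])
      (fun τ hτ => h.m1d hτ) (fun τ hτ => h.m2b hτ) τ τ'
  · exact fun t h τ τ' => Ex_lip (by simp) (by norm_num) (by simp)
      (fun τ hτ => h.n1d hτ) (fun τ hτ => h.n2b hτ) τ τ'

lemma K2_syo {a b : E2 → ℂ} (ha : Measurable a) (hb : Measurable b) : SyO (K2 a b) (AA a b) 0 := by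
  refine KG_syo (by norm_num) ha hb (EX_meas _ m2_meas) (EX_meas _ n2_meas) ?_ ?_ ?_ ?_
  · exact fun t h τ => Ex_bd (by simp) (fun τ hτ => h.m2b hτ) τ
  · exact fun t h τ => Ex_bd (by simp) (fun τ hτ => h.n2b hτ) τ
  · exact fun t h τ τ' => Ex_lip (by simp) (by norm_num) (by simp)
      (fun τ hτ => h.m2d hτ) (fun τ hτ => h.m3b hτ) τ τ'
  · exact fun t h τ τ' => Ex_lip (by simp) (by norm_num) (by simp [n2_zero])
      (fun τ hτ => h.n2d hτ) (fun τ hτ => h.n3b hτ) τ τ'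

lemma KG_deriv {i : ℕ} {a b : E2 → ℂ} {X Y X' Y' : ℂ × ℂ → ℝ → ℂ}
    (hX : ∀ t, Adm t → ∀ τ, HasDerivAt (X t) (X' t τ) τ)
    (hY : ∀ t, Adm t → ∀ τ, HasDerivAt (Y t) (Y' t τ) τ) (z : ℝ) (ξ : E2) :
    HasDerivAt (fun z => KG i a b X Y z ξ) (KG (i+1) a b X' Y' z ξ) z := by
  have hl : HasDerivAt (fun z : ℝ => sig ξ * z) (sig ξ) z := by
    simpa using (hasDerivAt_id z).const_mul (sig ξ)
  have h1 := ((hX _ (tt_adm ξ) (sig ξ * z)).scomp z hl).const_mul (a ξ)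
  have h2 := ((hY _ (tt_adm ξ) (sig ξ * z)).scomp z hl).const_mul (b ξ * (sig ξ : ℂ)⁻¹)
  refine ((h1.add h2).const_mul ((sig ξ : ℂ)^i)).congr_deriv ?_
  unfold KG
  simp only [Complex.real_smul]
  ring

lemma K0_deriv (a b : E2 → ℂ) (z : ℝ) (ξ : E2) :
    HasDerivAt (fun z => K0 a b z ξ) (K1 a b z ξ) z := by
  refine KG_deriv (fun t h τ => ?_) (fun t h τ => ?_) z ξ
  · exact Ex_deriv (by simp) (by simp [m1_zero]) (fun τ hτ => h.m0d hτ) τ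
  · have := Ex_deriv (ε := -1) (by simp [n0_zero]) (by simp) (fun τ hτ => h.n0d hτ) τ
    rwa [neg_neg] at this

lemma K1_deriv (a b : E2 → ℂ) (z : ℝ) (ξ : E2) :
    HasDerivAt (fun z => K1 a b z ξ) (K2 a b z ξ) z := by
  refine KG_deriv (fun t h τ => ?_) (fun t h τ => ?_) z ξ
  · have := Ex_deriv (ε := -1) (by simp [m1_zero]) (by simp) (fun τ hτ => h.m1d hτ) τ
    rwa [neg_neg] at this
  · exact Ex_deriv (by simp) (by simp [n2_zero]) (fun τ hτ => h.n1d hτ) τ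

lemma K0_zero (a b : E2 → ℂ) (ξ : E2) : K0 a b 0 ξ = a ξ := by
  simp [K0, KG, EX, Ex, m0_zero, n0_zero]

lemma K1_zero (a b : E2 → ℂ) (ξ : E2) : K1 a b 0 ξ = b ξ := by
  have : (sig ξ : ℂ) ≠ 0 := by exact_mod_cast (sig_pos ξ).ne'
  simp [K1, KG, EX, Ex, m1_zero, n1_zero]
  field_simp

lemma K0_lin (c : ℂ) (a b a' b' : E2 → ℂ) (z : ℝ) (ξ : E2) :
    K0 (fun ξ => c * a ξ + a' ξ) (fun ξ => c * b ξ + b' ξ) z ξ = c * K0 a b z ξ + K0 a' b' z ξ := by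
  unfold K0 KG; ring

/-- the lifting operator -/
def LL (φ ψ : E2 → ℝ) : E3 → ℝ :=
  TR (K0 (FH fun y => (φ y : ℂ)) (FH fun y => (ψ y : ℂ)))

/-- the total squared data norm -/
def Nsq (φ ψ : E2 → ℝ) (Gφ : Fin 2 → E2 → ℝ) (Hφ : Fin 2 → Fin 2 → E2 → ℝ)
        (Gψ : Fin 2 → E2 → ℝ) : ℝ := ((∫ y : E2, ((φ y) ^ 2 + ∑ d : Fin 2, (Gφ d y) ^ 2 +
                ∑ d : Fin 2, ∑ d' : Fin 2, (Hφ d d' y) ^ 2)) +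
              (∫ y : E2, ((ψ y) ^ 2 + ∑ d : Fin 2, (Gψ d y) ^ 2)))

lemma FH_sq {f : E2 → ℝ} (hf : MemLp f 2 (volume : Measure E2)) :
    Integrable (fun ξ => ‖FH (fun y => (f y : ℂ)) ξ‖ ^ 2) ∧
    ∫ ξ, ‖FH (fun y => (f y : ℂ)) ξ‖ ^ 2 = ∫ y, f y ^ 2 := by
  have hF := FH_memLp (fun y => (f y : ℂ))
  have h1 : Integrable (fun ξ => ‖FH (fun y => (f y : ℂ)) ξ‖ ^ 2) := hF.norm.integrable_sq
  refine ⟨h1, ?_⟩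
  have hc : MemLp (fun y => (f y : ℂ)) 2 (volume : Measure E2) := memLp_ofReal hf
  rw [integral_eq_lintegral_of_nonneg_ae (Filter.Eventually.of_forall fun x => sq_nonneg _) h1.1,
    integral_eq_lintegral_of_nonneg_ae (Filter.Eventually.of_forall fun x => sq_nonneg _)
      hf.integrable_sq.1]
  congr 1
  have := FH_lint hc
  have e1 : ∀ w : ℂ, ENNReal.ofReal (‖w‖ ^ 2) = ‖w‖ₑ ^ 2 := by
    intro w; rw [ENNReal.ofReal_pow (norm_nonneg _), ofReal_norm]
  have e2 : ∀ y, ENNReal.ofReal (f y ^ 2) = ‖(f y : ℂ)‖ₑ ^ 2 := by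
    intro y; rw [← e1]; simp
  simp_rw [e1, e2]
  exact this


/-- data hypotheses -/
structure Dat (φ ψ : E2 → ℝ) (Gφ : Fin 2 → E2 → ℝ) (Hφ : Fin 2 → Fin 2 → E2 → ℝ)
        (Gψ : Fin 2 → E2 → ℝ) : Prop where
  f : MemLp φ 2 (volume : Measure E2)
  g : ∀ d, MemLp (Gφ d) 2 (volume : Measure E2)
  h : ∀ d d', MemLp (Hφ d d') 2 (volume : Measure E2)
  fg : ∀ d, IsWeakD (univ : Set E2) φ (Gφ d) (EuclideanSpace.single d 1)
  gh : ∀ d d', IsWeakD (univ : Set E2) (Gφ d) (Hφ d d') (EuclideanSpace.single d' 1)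
  p : MemLp ψ 2 (volume : Measure E2)
  pg : ∀ d, MemLp (Gψ d) 2 (volume : Measure E2)
  pd : ∀ d, IsWeakD (univ : Set E2) ψ (Gψ d) (EuclideanSpace.single d 1)

lemma Dat.of {φ ψ : E2 → ℝ} {Gφ : Fin 2 → E2 → ℝ} {Hφ : Fin 2 → Fin 2 → E2 → ℝ}
        {Gψ : Fin 2 → E2 → ℝ} (h : MemH2W (univ : Set E2) φ Gφ Hφ)
        (h' : MemLp ψ 2 (volume : Measure E2) ∧ ∀ d, MemLp (Gψ d) 2 (volume : Measure E2) ∧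
          IsWeakD (univ : Set E2) ψ (Gψ d) (stdb2 d)) : Dat φ ψ Gφ Hφ Gψ := by
  unfold MemH2W L2on at h
  rw [Measure.restrict_univ] at h
  exact ⟨h.1, fun d => (h.2.1 d).1, fun d d' => (h.2.2 d d').1, fun d => (h.2.1 d).2,
    fun d d' => (h.2.2 d d').2, h'.1, fun d => (h'.2 d).1, fun d => (h'.2 d).2⟩

/-- transform of a real function -/
def FR (f : E2 → ℝ) : E2 → ℂ := FH fun y => (f y : ℂ)

section
variable {φ ψ : E2 → ℝ} {Gφ : Fin 2 → E2 → ℝ} {Hφ : Fin 2 → Fin 2 → E2 → ℝ}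
        {Gψ : Fin 2 → E2 → ℝ}

lemma sig_sq (ξ : E2) : sig ξ ^ 2 ≤ 12 * (1 + (2 * π * |ξ 0|)^2 + (2 * π * |ξ 1|)^2) := by
  have h1 := sig_upper ξ
  have h2 := sig_pos ξ
  set a := 2 * π * |ξ 0|
  set b := 2 * π * |ξ 1|
  have : sig ξ ^ 2 ≤ (2 + a + b)^2 := by gcongr
  nlinarith [sq_nonneg (a-b), sq_nonneg (2 - a), sq_nonneg (2-b), sq_nonneg a, sq_nonneg b]

lemma xnorm (t : ℝ) : ‖(2 * π * Complex.I * (t : ℂ))‖ = 2 * π * |t| := by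
  simp [abs_of_pos pi_pos]

lemma Dat.h2 (D : Dat φ ψ Gφ Hφ Gψ) (d : Fin 2) : ∀ᵐ ξ, ‖FR (Hφ d d) ξ‖ =
    (2 * π * |ξ d|)^2 * ‖FR φ ξ‖ := by
  filter_upwards [FH_weak D.f (D.g d) (D.fg d), FH_weak (D.g d) (D.h d d) (D.gh d d)] with ξ h1 h2
  unfold FR
  rw [h2, h1, norm_mul, xnorm, norm_mul, xnorm]
  ring

lemma Dat.h1 (D : Dat φ ψ Gφ Hφ Gψ) (d : Fin 2) : ∀ᵐ ξ, ‖FR (Gψ d) ξ‖ =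
    (2 * π * |ξ d|) * ‖FR ψ ξ‖ := by
  filter_upwards [FH_weak D.p (D.pg d) (D.pd d)] with ξ h1
  unfold FR
  rw [h1, norm_mul, xnorm]

def BB (φ ψ : E2 → ℝ) (Hφ : Fin 2 → Fin 2 → E2 → ℝ) (Gψ : Fin 2 → E2 → ℝ) (ξ : E2) : ℝ :=
  ‖FR φ ξ‖^2 + ‖FR (Hφ 0 0) ξ‖^2 + ‖FR (Hφ 1 1) ξ‖^2 +
    (‖FR ψ ξ‖^2 + ‖FR (Gψ 0) ξ‖^2 + ‖FR (Gψ 1) ξ‖^2)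

def CB : ℝ := 864 * 128000 ^ 2

lemma Dat.AA_le (D : Dat φ ψ Gφ Hφ Gψ) : ∀ᵐ ξ, AA (FR φ) (FR ψ) ξ ^ 2 ≤ CB * BB φ ψ Hφ Gψ ξ := by
  filter_upwards [D.h2 0, D.h2 1, D.h1 0, D.h1 1] with ξ a0 a1 b0 b1
  unfold AA BB CB
  have hs := sig_sq ξ
  have e : ‖FR ψ ξ‖^2 + ‖FR (Gψ 0) ξ‖^2 + ‖FR (Gψ 1) ξ‖^2 =
      (1 + (2 * π * |ξ 0|)^2 + (2 * π * |ξ 1|)^2) * ‖FR ψ ξ‖^2 := by rw [b0, b1]; ring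
  have hp : (sig ξ * ‖FR ψ ξ‖)^2 ≤ 12 * (‖FR ψ ξ‖^2 + ‖FR (Gψ 0) ξ‖^2 + ‖FR (Gψ 1) ξ‖^2) := by
    rw [e, mul_pow, ← mul_assoc]
    gcongr
  have hf : sig ξ ^ 2 * ‖FR φ ξ‖ ≤ 12 * (‖FR φ ξ‖ + ‖FR (Hφ 0 0) ξ‖ + ‖FR (Hφ 1 1) ξ‖) := by
    rw [a0, a1]
    calc _ ≤ 12 * (1 + (2 * π * |ξ 0|)^2 + (2 * π * |ξ 1|)^2) * ‖FR φ ξ‖ := by gcongr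
      _ = _ := by ring
  have hs0 := sig_pos ξ
  generalize ‖FR (Hφ 0 0) ξ‖ = x at *
  generalize ‖FR (Hφ 1 1) ξ‖ = y at *
  generalize ‖FR (Gψ 0) ξ‖^2 = u at *
  have h3 : (sig ξ ^ 2 * ‖FR φ ξ‖)^2 ≤ 432 * (‖FR φ ξ‖^2 + x^2 + y^2) := by
    have : (sig ξ ^ 2 * ‖FR φ ξ‖)^2 ≤ (12 * (‖FR φ ξ‖ + x + y))^2 := by gcongr
    nlinarith [sq_nonneg (‖FR φ ξ‖ - x), sq_nonneg (‖FR φ ξ‖ - y), sq_nonneg (x - y)]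
  have h4 : 0 ≤ ‖FR ψ ξ‖^2 + u + ‖FR (Gψ 1) ξ‖^2 := by nlinarith [sq_nonneg (sig ξ * ‖FR ψ ξ‖)]
  rw [mul_pow]
  nlinarith [sq_nonneg (sig ξ ^ 2 * ‖FR φ ξ‖ - sig ξ * ‖FR ψ ξ‖)]

lemma Dat.BB_int (D : Dat φ ψ Gφ Hφ Gψ) : Integrable (BB φ ψ Hφ Gψ) := by
  unfold BB
  exact (((FH_sq D.f).1.add (FH_sq (D.h 0 0)).1).add (FH_sq (D.h 1 1)).1).add
    (((FH_sq D.p).1.add (FH_sq (D.pg 0)).1).add (FH_sq (D.pg 1)).1)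

lemma Dat.BB_le (D : Dat φ ψ Gφ Hφ Gψ) : ∫ ξ, BB φ ψ Hφ Gψ ξ ≤ Nsq φ ψ Gφ Hφ Gψ := by
  have add3 : ∀ {f g h : E2 → ℝ}, Integrable f → Integrable g → Integrable h →
      Integrable (fun x => f x + g x + h x) ∧
      ∫ x, (f x + g x + h x) = (∫ x, f x) + (∫ x, g x) + ∫ x, h x := by
    intro f g h hf hg hh
    refine ⟨(hf.add hg).add hh, ?_⟩
    rw [integral_add (f := fun x => f x + g x) (hf.add hg) hh, integral_add hf hg]
  have s1 := add3 (FH_sq D.f).1 (FH_sq (D.h 0 0)).1 (FH_sq (D.h 1 1)).1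
  have s2 := add3 (FH_sq D.p).1 (FH_sq (D.pg 0)).1 (FH_sq (D.pg 1)).1
  rw [(FH_sq D.f).2, (FH_sq (D.h 0 0)).2, (FH_sq (D.h 1 1)).2] at s1
  rw [(FH_sq D.p).2, (FH_sq (D.pg 0)).2, (FH_sq (D.pg 1)).2] at s2
  have e : ∫ ξ, BB φ ψ Hφ Gψ ξ = (∫ y, φ y ^ 2) + (∫ y, Hφ 0 0 y ^ 2) + (∫ y, Hφ 1 1 y ^ 2) +
      ((∫ y, ψ y ^ 2) + (∫ y, Gψ 0 y ^ 2) + (∫ y, Gψ 1 y ^ 2)) := by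
    rw [← s1.2, ← s2.2, ← integral_add s1.1 s2.1]
    rfl
  have t1 := add3 D.f.integrable_sq (D.h 0 0).integrable_sq (D.h 1 1).integrable_sq
  have t2 := add3 D.p.integrable_sq (D.pg 0).integrable_sq (D.pg 1).integrable_sq
  rw [e, ← t1.2, ← t2.2]
  unfold Nsq
  have i1 : Integrable (fun y => ∑ d : Fin 2, (Gφ d y) ^ 2) :=
    integrable_finsetSum _ fun d _ => (D.g d).integrable_sq
  have i2 : Integrable (fun y => ∑ d : Fin 2, ∑ d' : Fin 2, (Hφ d d' y) ^ 2) :=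
    integrable_finsetSum _ fun d _ => integrable_finsetSum _ fun d' _ => (D.h d d').integrable_sq
  have i3 : Integrable (fun y => ∑ d : Fin 2, (Gψ d y) ^ 2) :=
    integrable_finsetSum _ fun d _ => (D.pg d).integrable_sq
  apply add_le_add
  · refine integral_mono t1.1 ((D.f.integrable_sq.add i1).add i2) fun y => ?_
    simp only [Fin.sum_univ_two, Pi.add_apply]
    nlinarith [sq_nonneg (Gφ 0 y), sq_nonneg (Gφ 1 y), sq_nonneg (Hφ 0 1 y), sq_nonneg (Hφ 1 0 y)]
  · refine integral_mono t2.1 (D.p.integrable_sq.add i3) fun y => ?_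
    simp only [Fin.sum_univ_two, Pi.add_apply]
    linarith

lemma AA_meas (a b : E2 → ℂ) (ha : Measurable a) (hb : Measurable b) : Measurable (AA a b) := by
  unfold AA
  have := sig_cont.measurable
  fun_prop

lemma FR_meas (f : E2 → ℝ) : Measurable (FR f) := (FH_meas _).measurable

lemma Dat.AA_mem (D : Dat φ ψ Gφ Hφ Gψ) : MemLp (AA (FR φ) (FR ψ)) 2 (volume : Measure E2) := by
  have hm : Measurable (AA (FR φ) (FR ψ)) := AA_meas _ _ (FR_meas _) (FR_meas _)
  rw [memLp_two_iff_integrable_sq hm.aestronglyMeasurable]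
  refine (D.BB_int.const_mul CB).mono' (hm.pow_const 2).aestronglyMeasurable ?_
  filter_upwards [D.AA_le] with ξ h
  rwa [Real.norm_of_nonneg (sq_nonneg _)]

lemma Dat.AA_int (D : Dat φ ψ Gφ Hφ Gψ) : ∫ ξ, AA (FR φ) (FR ψ) ξ ^ 2 ≤ CB * Nsq φ ψ Gφ Hφ Gψ := by
  calc _ ≤ ∫ ξ, CB * BB φ ψ Hφ Gψ ξ :=
        integral_mono_ae D.AA_mem.integrable_sq (D.BB_int.const_mul CB) D.AA_le
    _ = CB * ∫ ξ, BB φ ψ Hφ Gψ ξ := integral_const_mul _ _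
    _ ≤ _ := by
      have : 0 ≤ CB := by unfold CB; norm_num
      have := D.BB_le
      gcongr
end


section
variable {φ ψ : E2 → ℝ} {Gφ : Fin 2 → E2 → ℝ} {Hφ : Fin 2 → Fin 2 → E2 → ℝ}
        {Gψ : Fin 2 → E2 → ℝ}

lemma LL_eq (φ ψ : E2 → ℝ) (x : E3) : LL φ ψ x = (𝓕⁻ (K0 (FR φ) (FR ψ) (x 2)) (pr x)).re := rfl

lemma Dat.syo (_D : Dat φ ψ Gφ Hφ Gψ) : SyO (K0 (FR φ) (FR ψ)) (AA (FR φ) (FR ψ)) 2 :=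
  K0_syo (FR_meas _) (FR_meas _)

lemma Dat.gD (D : Dat φ ψ Gφ Hφ Gψ) : Integrable (fun ξ => AA (FR φ) (FR ψ) ξ * ((sig ξ)^2)⁻¹) :=
  D.AA_mem.integrable_mul sig_memLp

lemma Dat.bd (D : Dat φ ψ Gφ Hφ Gψ) (z : ℝ) (ξ : E2) :
    ‖K0 (FR φ) (FR ψ) z ξ‖ ≤ AA (FR φ) (FR ψ) ξ * ((sig ξ)^2)⁻¹ := by
  refine (D.syo.bd z ξ).trans ?_
  have := D.syo.A_nonneg ξ
  have h2 : (dz (sig ξ * z))^2 ≤ 1 := pow_le_one₀ (dz_nonneg _) (dz_le_one _)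
  exact mul_le_of_le_one_right (by positivity) h2

lemma Dat.K_meas (D : Dat φ ψ Gφ Hφ Gψ) (z : ℝ) : Measurable (K0 (FR φ) (FR ψ) z) :=
  Measurable.of_uncurry_left D.syo.meas

lemma Dat.K_int (D : Dat φ ψ Gφ Hφ Gψ) (z : ℝ) : Integrable (K0 (FR φ) (FR ψ) z) :=
  D.gD.mono' (D.K_meas z).aestronglyMeasurable (Filter.Eventually.of_forall (D.bd z))

lemma Dat.cont (D : Dat φ ψ Gφ Hφ Gψ) : Continuous (LL φ ψ) := by
  refine Complex.continuous_re.comp ?_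
  unfold TC
  simp_rw [Real.fourierInv_eq']
  refine continuous_of_dominated (bound := fun ξ => AA (FR φ) (FR ψ) ξ * ((sig ξ)^2)⁻¹) ?_ ?_ D.gD ?_
  · intro x
    have := D.K_meas (x 2)
    exact Measurable.aestronglyMeasurable (by unfold FR at this; fun_prop)
  · intro x
    refine Filter.Eventually.of_forall fun ξ => ?_
    rw [norm_smul, Complex.norm_exp_ofReal_mul_I, one_mul]
    exact D.bd _ ξ
  · refine Filter.Eventually.of_forall fun ξ => ?_
    have h1 := pr_cont
    have h2 : Continuous (fun z => K0 (FR φ) (FR ψ) z ξ) :=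
      continuous_iff_continuousAt.2 fun z => (K0_deriv _ _ z ξ).continuousAt
    have h3 : Continuous (fun x : E3 => K0 (FR φ) (FR ψ) (x 2) ξ) := h2.comp (by fun_prop)
    unfold FR at h3
    fun_prop

lemma pr_emb (y : E2) : pr (embPlane y) = y ∧ embPlane y 2 = 0 := by
  have := e3_jn 0 y
  rw [jn_embPlane, e3_apply, Prod.mk.injEq] at this
  exact ⟨this.2, this.1⟩

lemma Dat.trace (D : Dat φ ψ Gφ Hφ Gψ) : ∀ᵐ y : E2, LL φ ψ (embPlane y) = φ y := by
  have e : K0 (FR φ) (FR ψ) 0 = FR φ := funext fun ξ => K0_zero _ _ ξ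
  have hi : Integrable (FR φ) := by have := D.K_int 0; rwa [e] at this
  filter_upwards [FH_inv (memLp_ofReal D.f) hi] with y hy
  rw [LL_eq, (pr_emb y).1, (pr_emb y).2, e]
  unfold FR
  rw [hy]
  simp

lemma inv_conv {b : E2 → ℂ} (hb : Integrable b) (y : E2) :
    Integrable (fun v => Real.fourierChar ⟪v, y⟫ • b v) := by
  exact (Real.fourierIntegral_convergent_iff (V := E2) (-y) |>.2 hb).congr (by simp)

lemma inv_lin {b g : E2 → ℂ} (hb : Integrable b) (hg : Integrable g) (c : ℂ) (y : E2) :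
    𝓕⁻ (fun ξ => c * b ξ + g ξ) y = c * 𝓕⁻ b y + 𝓕⁻ g y := by
  simp_rw [Real.fourierInv_eq]
  have i1 : Integrable (fun v => Real.fourierChar ⟪v, y⟫ • b v) :=
    inv_conv hb y
  have i2 : Integrable (fun v => Real.fourierChar ⟪v, y⟫ • g v) :=
    inv_conv hg y
  rw [← integral_const_mul, ← integral_add (i1.const_mul c) i2]
  congr 1
  ext v
  simp only [Circle.smul_def, smul_eq_mul]
  ring

lemma inv_congr {b g : E2 → ℂ} (h : b =ᵐ[volume] g) (y : E2) : 𝓕⁻ b y = 𝓕⁻ g y := by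
  simp_rw [Real.fourierInv_eq]
  apply integral_congr_ae
  filter_upwards [h] with ξ hξ
  rw [hξ]

lemma Dat.lin {φ' ψ' : E2 → ℝ} {Gφ' : Fin 2 → E2 → ℝ} {Hφ' : Fin 2 → Fin 2 → E2 → ℝ}
    {Gψ' : Fin 2 → E2 → ℝ} (D : Dat φ ψ Gφ Hφ Gψ) (D' : Dat φ' ψ' Gφ' Hφ' Gψ') (a : ℝ) (x : E3) :
    LL (fun y => a * φ y + φ' y) (fun y => a * ψ y + ψ' y) x = a * LL φ ψ x + LL φ' ψ' x := by
  have l : ∀ {f g : E2 → ℝ}, MemLp f 2 (volume : Measure E2) → MemLp g 2 (volume : Measure E2) →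
      FR (fun y => a * f y + g y) =ᵐ[volume] fun ξ => (a : ℂ) * FR f ξ + FR g ξ := by
    intro f g hf hg
    have := FH_lin (memLp_ofReal hf) (memLp_ofReal hg) (a : ℂ)
    unfold FR
    push_cast
    exact this
  simp only [LL_eq]
  rw [inv_congr (g := fun ξ => (a : ℂ) * K0 (FR φ) (FR ψ) (x 2) ξ + K0 (FR φ') (FR ψ') (x 2) ξ),
    inv_lin (D.K_int _) (D'.K_int _)]
  · simp
  · filter_upwards [l D.f D'.f, l D.p D'.p] with ξ h1 h2
    rw [← K0_lin]
    unfold K0 KG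
    rw [h1, h2]

theorem Dat.prof (D : Dat φ ψ Gφ Hφ Gψ) :
    ∃ G Hs, MemH2W (univ : Set E3) (LL φ ψ) G Hs ∧
          (∀ d d', GagH12 (univ : Set E3) (Hs d d')) ∧
          (∫ x : E3, ((LL φ ψ x) ^ 2 + ∑ d : Fin 3, (G d x) ^ 2 +
              ∑ d : Fin 3, ∑ d' : Fin 3, (Hs d d' x) ^ 2)) +
            (∑ d : Fin 3, ∑ d' : Fin 3, GagSqVal (univ : Set E3) (Hs d d'))
            ≤ Cprof * ∫ ξ, AA (FR φ) (FR ψ) ξ ^ 2 ∧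
          HalfTrace3 (G 2) (fun d => Hs 2 d) ψ :=
  profile D.AA_mem D.syo (K1_syo (FR_meas _) (FR_meas _)) (K2_syo (FR_meas _) (FR_meas _))
    (K0_deriv _ _) (K1_deriv _ _) D.p (K1_zero _ _)
end


lemma inv_trans (η : 𝓢(E2, ℂ)) (a ξ : E2) :
    𝓕⁻ (η.compSubConstCLM ℂ a) ξ = Complex.exp ((2 * π * ⟪a, ξ⟫ : ℝ) * Complex.I) * 𝓕⁻ η ξ := by
  rw [SchwartzMap.fourierInv_coe, SchwartzMap.fourierInv_coe, Real.fourierInv_eq', Real.fourierInv_eq',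
    ← integral_const_mul]
  have := integral_sub_right_eq_self (μ := (volume : Measure E2))
    (fun v => Complex.exp ((2 * π * ⟪a, ξ⟫ : ℝ) * Complex.I) *
      (Complex.exp ((2 * π * ⟪v, ξ⟫ : ℝ) * Complex.I) • η v)) a
  rw [← this]
  congr 1
  ext v
  simp only [SchwartzMap.compSubConstCLM_apply, smul_eq_mul]
  rw [← mul_assoc, ← Complex.exp_add, inner_sub_left]
  congr 2
  push_cast
  ring

/-- spectral version of vanishing on `x_j < 0` -/
structure Vn (j : Fin 2) (b : E2 → ℂ) : Prop where
  mem : MemLp b 2 (volume : Measure E2)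
  van : ∀ η : 𝓢(E2, ℂ), (∀ x : E2, 0 ≤ x j → η x = 0) → ∫ ξ, b ξ * 𝓕⁻ η ξ = 0

lemma Vn.int {j : Fin 2} {b : E2 → ℂ} (h : Vn j b) (η : 𝓢(E2, ℂ)) :
    Integrable (fun ξ => b ξ * 𝓕⁻ η ξ) :=
  h.mem.integrable_mul ((𝓕⁻ η).memLp 2 volume)

lemma Vn.lin {j : Fin 2} {b g : E2 → ℂ} (hb : Vn j b) (hg : Vn j g) (c : ℂ) :
    Vn j (fun ξ => c * b ξ + g ξ) where
  mem := (hb.mem.const_mul c).add hg.mem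
  van η hη := by
    have e : ∀ ξ, (c * b ξ + g ξ) * 𝓕⁻ η ξ = c * (b ξ * 𝓕⁻ η ξ) + g ξ * 𝓕⁻ η ξ := by
      intro; ring
    simp_rw [e]
    rw [integral_add ((hb.int η).const_mul c) (hg.int η), integral_const_mul, hb.van η hη,
      hg.van η hη]
    simp

lemma Vn.of {j : Fin 2} {f : E2 → ℝ} (hf : MemLp f 2 (volume : Measure E2))
    (h : ∀ᵐ y : E2, y j < 0 → f y = 0) : Vn j (FR f) where
  mem := FH_memLp _
  van η hη := by
    have := FH_pair (memLp_ofReal hf) (𝓕⁻ η)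
    rw [FourierTransform.fourier_fourierInv_eq] at this
    unfold FR
    simp_rw [mul_comm (FH _ _)]
    rw [this]
    rw [← integral_zero E2 ℂ (μ := volume)]
    apply integral_congr_ae
    filter_upwards [h] with y hy
    rcases lt_or_ge (y j) 0 with h1 | h1
    · rw [hy h1]; simp
    · rw [hη y h1]; simp

lemma res_eq {s : ℂ} (hs : 0 < s.re) : s⁻¹ = ∫ u : ℝ in Ioi 0, Complex.exp (-s * u) := by
  rw [integral_exp_mul_complex_Ioi (by simpa using hs)]
  simp

lemma one_add_re (i : Fin 2) (ξ : E2) {z : ℝ} (hz : 0 ≤ z) : 1 ≤ (1 + z * sj i ξ).re := by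
  simp [sj_re, hz]

lemma Vn.mul {j : Fin 2} {b : E2 → ℂ} (h : Vn j b) (i : Fin 2) {z : ℝ} (hz : 0 ≤ z) :
    Vn j (fun ξ => b ξ * (1 + z * sj i ξ)⁻¹) where
  mem := by
    have hm : Measurable (fun ξ => (1 + z * sj i ξ)⁻¹) := by
      have := (sj_cont i).measurable
      fun_prop
    refine MemLp.of_le h.mem (h.mem.1.mul hm.aestronglyMeasurable)
      (Filter.Eventually.of_forall fun ξ => ?_)
    rw [norm_mul, norm_inv]
    refine mul_le_of_le_one_right (norm_nonneg _) (inv_le_one_of_one_le₀ ?_)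
    exact (one_add_re i ξ hz).trans (Complex.re_le_norm _)
  van η hη := by
    have e1 : ∀ ξ, b ξ * (1 + z * sj i ξ)⁻¹ * 𝓕⁻ η ξ =
        ∫ u : ℝ in Ioi 0, b ξ * 𝓕⁻ η ξ * Complex.exp (-(1 + z * sj i ξ) * u) := by
      intro ξ
      rw [integral_const_mul, ← res_eq (by linarith [one_add_re i ξ hz])]
      ring
    simp_rw [e1]
    have hi : Integrable (fun p : E2 × ℝ => b p.1 * 𝓕⁻ η p.1 *
        Complex.exp (-(1 + z * sj i p.1) * p.2)) (volume.prod (volume.restrict (Ioi 0))) := by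
      have hg : Integrable (fun u : ℝ => Real.exp (-u)) (volume.restrict (Ioi 0)) := by
        have := integrableOn_exp_mul_Ioi (a := -1) (by norm_num) 0
        simpa [IntegrableOn] using this
      have hp := (h.int η).norm.mul_prod hg
      refine hp.mono' ?_ ?_
      · refine AEStronglyMeasurable.mul (h.int η).1.comp_fst ?_
        have := sj_cont i
        exact Continuous.aestronglyMeasurable (by fun_prop)
      · have : ∀ᵐ p : E2 × ℝ ∂(volume.prod (volume.restrict (Ioi 0))), p.2 ∈ Ioi (0:ℝ) :=
          Measure.quasiMeasurePreserving_snd.ae (ae_restrict_mem measurableSet_Ioi)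
        filter_upwards [this] with p hp
        rw [norm_mul]
        gcongr
        rw [Complex.norm_exp]
        apply Real.exp_le_exp.2
        have h1 := one_add_re i p.1 hz
        have h2 : (0:ℝ) < p.2 := hp
        rw [Complex.re_mul_ofReal, Complex.neg_re]
        nlinarith
    rw [integral_integral_swap hi]
    rw [← integral_zero ℝ ℂ (μ := volume.restrict (Ioi 0))]
    apply setIntegral_congr_fun measurableSet_Ioi
    intro u hu
    have hu : (0:ℝ) < u := hu
    have e2 : ∀ ξ, b ξ * 𝓕⁻ η ξ * Complex.exp (-(1 + z * sj i ξ) * u) =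
        Complex.exp (-(1 + z) * u) *
          (b ξ * 𝓕⁻ (η.compSubConstCLM ℂ (EuclideanSpace.single i (-(u * z)))) ξ) := by
      intro ξ
      rw [inv_trans]
      have e3 : Complex.exp (-(1 + z * sj i ξ) * u) = Complex.exp (-(1 + z) * u) *
          Complex.exp ((2 * π * ⟪(EuclideanSpace.single i (-(u * z)) : E2), ξ⟫ : ℝ) * Complex.I) := by
        rw [← Complex.exp_add]
        congr 1
        rw [EuclideanSpace.inner_single_left]
        unfold sj
        simp
        ring
      rw [e3]
      ring
    simp_rw [e2]
    rw [integral_const_mul, h.van, mul_zero]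
    intro x hx
    rw [SchwartzMap.compSubConstCLM_apply]
    apply hη
    have : 0 ≤ u * z := by positivity
    by_cases hij : j = i
    · subst hij; simp; linarith
    · simp [hij, hx]

lemma Vn.congr {j : Fin 2} {b g : E2 → ℂ} (h : Vn j b) (e : b = g) : Vn j g := e ▸ h

/-- resolvent product -/
def wz (z : ℝ) (ξ : E2) : ℂ := (1 + z * sj 0 ξ)⁻¹ * (1 + z * sj 1 ξ)⁻¹

lemma Vn.w {j : Fin 2} {b : E2 → ℂ} (h : Vn j b) {z : ℝ} (hz : 0 ≤ z) (k : ℕ) :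
    Vn j (fun ξ => b ξ * wz z ξ ^ k) := by
  induction k with
  | zero => simpa using h
  | succ k ih =>
    refine ((ih.mul 0 hz).mul 1 hz).congr ?_
    funext ξ
    unfold wz
    ring

lemma K0_eq (a b : E2 → ℂ) (z : ℝ) (ξ : E2) :
    K0 a b z ξ = (z * b ξ + a ξ) * (wz |z| ξ ^ 5 * (6 - 5 * wz |z| ξ)) := by
  have hs : (sig ξ : ℂ) ≠ 0 := by exact_mod_cast (sig_pos ξ).ne'
  have hp : ∀ r : ℝ, wW (tt ξ) (sig ξ * r) = wz r ξ := by
    intro r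
    unfold wW pP wz tt
    have e : ∀ s : ℂ, ((sig ξ * r : ℝ) : ℂ) * (s / (sig ξ : ℂ)) = r * s := by
      intro s; push_cast; field_simp
    simp only [e]
  unfold K0 KG EX Ex n0 m0
  rcases le_or_gt 0 z with h | h
  · have h1 : 0 ≤ sig ξ * z := mul_nonneg (sig_pos ξ).le h
    rw [if_pos h1, if_pos h1, hp, abs_of_nonneg h]
    push_cast
    field_simp
    ring
  · have h1 : ¬ 0 ≤ sig ξ * z := by
      have := mul_neg_of_pos_of_neg (sig_pos ξ) h
      linarith
    rw [if_neg h1, if_neg h1, ← mul_neg, hp, abs_of_neg h]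
    push_cast
    field_simp
    ring

section
variable {φ ψ : E2 → ℝ} {Gφ : Fin 2 → E2 → ℝ} {Hφ : Fin 2 → Fin 2 → E2 → ℝ}
        {Gψ : Fin 2 → E2 → ℝ}

lemma Dat.vanish (D : Dat φ ψ Gφ Hφ Gψ) (j : Fin 2) (h1 : ∀ᵐ y : E2, y j < 0 → φ y = 0)
    (h2 : ∀ᵐ y : E2, y j < 0 → ψ y = 0) (z : ℝ) (y : E2) (hy : y j < 0) :
    𝓕⁻ (K0 (FR φ) (FR ψ) z) y = 0 := by
  have hV : Vn j (K0 (FR φ) (FR ψ) z) := by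
    have v0 := (Vn.of D.p h2).lin (Vn.of D.f h1) z
    have v1 := v0.w (abs_nonneg z) 5
    have v2 := v0.w (abs_nonneg z) 6
    have v3 := (v2.lin (v1.lin v1 0) (-(5/6)))
    have v4 := v3.lin (v3.lin v3 0) 5
    refine v4.congr (funext fun ξ => ?_)
    rw [K0_eq]
    ring
  have hi := D.K_int z
  have hc := inv_continuous hi
  have ho : IsOpen {y : E2 | y j < 0} := isOpen_lt (by fun_prop) continuous_const
  have ha := ho.ae_eq_zero_of_integral_contDiff_smul_eq_zero (f := 𝓕⁻ (K0 (FR φ) (FR ψ) z))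
    (μ := volume) (hc.locallyIntegrable.locallyIntegrableOn _) (by
      intro g hg hcs hsup
      have hg₁ : HasCompactSupport (Complex.ofRealCLM ∘ g) := hcs.comp_left rfl
      have hg₂ : ContDiff ℝ ∞ (Complex.ofRealCLM ∘ g) := by fun_prop
      set G : 𝓢(E2, ℂ) := hg₁.toSchwartzMap hg₂ with hG
      have hGx : ∀ x, G x = (g x : ℂ) := fun x => rfl
      have h4 : ∫ x, g x • 𝓕⁻ (K0 (FR φ) (FR ψ) z) x = ∫ x, 𝓕⁻ (K0 (FR φ) (FR ψ) z) x * G x := by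
        congr 1; ext x; rw [hGx, Complex.real_smul, mul_comm]
      rw [h4, inv_pair hi G.integrable, ← SchwartzMap.fourierInv_coe]
      apply hV.van
      intro x hx
      rw [hGx]
      have : g x = 0 := by
        by_contra hne
        have := hsup (subset_tsupport g hne)
        simp only [mem_setOf_eq] at this
        linarith
      rw [this]; simp)
  have := Measure.eqOn_open_of_ae_eq (μ := (volume : Measure E2)) (g := fun _ => (0:ℂ))
    ((ae_restrict_iff' ho.measurableSet).2 ha) ho hc.continuousOn continuousOn_const
  exact this hy

lemma Dat.supp (D : Dat φ ψ Gφ Hφ Gψ) (j : Fin 2) (h1 : ∀ᵐ y : E2, y j < 0 → φ y = 0)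
    (h2 : ∀ᵐ y : E2, y j < 0 → ψ y = 0) (x : E3) (hx : pr x j < 0) : LL φ ψ x = 0 := by
  rw [LL_eq, D.vanish j h1 h2 _ _ hx]
  simp
end

lemma Nsq_nonneg (φ ψ : E2 → ℝ) (Gφ : Fin 2 → E2 → ℝ) (Hφ : Fin 2 → Fin 2 → E2 → ℝ)
    (Gψ : Fin 2 → E2 → ℝ) : 0 ≤ Nsq φ ψ Gφ Hφ Gψ := by
  unfold Nsq
  exact add_nonneg (integral_nonneg fun y => by positivity) (integral_nonneg fun y => by positivity)

lemma Cprof_nonneg : 0 ≤ Cprof := by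
  unfold Cprof
  positivity

lemma CB_nonneg : 0 ≤ CB := by
  unfold CB
  positivity

theorem lifting_operator_L2 :
    ∃ (L : (E2 → ℝ) → (E2 → ℝ) → E3 → ℝ) (C : ℝ), 0 < C ∧
      -- linearity
      (∀ (a : ℝ) (φ ψ φ' ψ' : E2 → ℝ)
        (Gφ : Fin 2 → E2 → ℝ) (Hφ : Fin 2 → Fin 2 → E2 → ℝ) (Gψ : Fin 2 → E2 → ℝ)
        (Gφ' : Fin 2 → E2 → ℝ) (Hφ' : Fin 2 → Fin 2 → E2 → ℝ) (Gψ' : Fin 2 → E2 → ℝ),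
        MemH2W (univ : Set E2) φ Gφ Hφ →
        (MemLp ψ 2 (volume : Measure E2) ∧ ∀ d, MemLp (Gψ d) 2 (volume : Measure E2) ∧
          IsWeakD (univ : Set E2) ψ (Gψ d) (stdb2 d)) →
        MemH2W (univ : Set E2) φ' Gφ' Hφ' →
        (MemLp ψ' 2 (volume : Measure E2) ∧ ∀ d, MemLp (Gψ' d) 2 (volume : Measure E2) ∧
          IsWeakD (univ : Set E2) ψ' (Gψ' d) (stdb2 d)) →
        ∀ x, L (fun y => a * φ y + φ' y) (fun y => a * ψ y + ψ' y) x
          = a * L φ ψ x + L φ' ψ' x) ∧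
      ∀ (φ ψ : E2 → ℝ) (Gφ : Fin 2 → E2 → ℝ) (Hφ : Fin 2 → Fin 2 → E2 → ℝ)
        (Gψ : Fin 2 → E2 → ℝ),
        -- φ ∈ H²(ℝ²), ψ ∈ H¹(ℝ²)
        MemH2W (univ : Set E2) φ Gφ Hφ →
        (MemLp ψ 2 (volume : Measure E2) ∧ ∀ d, MemLp (Gψ d) 2 (volume : Measure E2) ∧
          IsWeakD (univ : Set E2) ψ (Gψ d) (stdb2 d)) →
        -- L(φ,ψ) ∈ H^{5/2}(ℝ³), boundedly
        Continuous (L φ ψ) ∧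
        (∃ G Hs, MemH2W (univ : Set E3) (L φ ψ) G Hs ∧
          (∀ d d', GagH12 (univ : Set E3) (Hs d d')) ∧
          (∫ x : E3, ((L φ ψ x) ^ 2 + ∑ d : Fin 3, (G d x) ^ 2 +
              ∑ d : Fin 3, ∑ d' : Fin 3, (Hs d d' x) ^ 2)) +
            (∑ d : Fin 3, ∑ d' : Fin 3, GagSqVal (univ : Set E3) (Hs d d'))
            ≤ C * ((∫ y : E2, ((φ y) ^ 2 + ∑ d : Fin 2, (Gφ d y) ^ 2 +
                ∑ d : Fin 2, ∑ d' : Fin 2, (Hφ d d' y) ^ 2)) +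
              (∫ y : E2, ((ψ y) ^ 2 + ∑ d : Fin 2, (Gψ d y) ^ 2))) ∧
          -- (i) trace of L(φ,ψ) on the plane x₃ = 0 is φ
          (∀ᵐ y : E2, L φ ψ (embPlane y) = φ y) ∧
          -- (ii) trace of ∂L(φ,ψ)/∂x₃ on the plane x₃ = 0 is ψ
          HalfTrace3 (G 2) (fun d => Hs 2 d) ψ) ∧
        -- (iii) support properties
        ((∀ᵐ y : E2, y 0 < 0 → φ y = 0) → (∀ᵐ y : E2, y 0 < 0 → ψ y = 0) →
          ∀ x : E3, x 0 < 0 → L φ ψ x = 0) ∧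
        ((∀ᵐ y : E2, y 1 < 0 → φ y = 0) → (∀ᵐ y : E2, y 1 < 0 → ψ y = 0) →
          ∀ x : E3, x 1 < 0 → L φ ψ x = 0) := by
  refine ⟨LL, Cprof * CB + 1, by have := mul_nonneg Cprof_nonneg CB_nonneg; linarith, ?_, ?_⟩
  · intro a φ ψ φ' ψ' Gφ Hφ Gψ Gφ' Hφ' Gψ' h1 h2 h3 h4 x
    exact (Dat.of h1 h2).lin (Dat.of h3 h4) a x
  · intro φ ψ Gφ Hφ Gψ h h'
    have D := Dat.of h h'
    obtain ⟨G, Hs, hm, hg, hb, ht⟩ := D.prof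
    refine ⟨D.cont, ⟨G, Hs, hm, hg, ?_, D.trace, ht⟩, ?_, ?_⟩
    · refine hb.trans ?_
      have hN := Nsq_nonneg φ ψ Gφ Hφ Gψ
      have h1 := mul_le_mul_of_nonneg_left D.AA_int Cprof_nonneg
      have h2 : Cprof * (CB * Nsq φ ψ Gφ Hφ Gψ) ≤ (Cprof * CB + 1) * Nsq φ ψ Gφ Hφ Gψ := by
        nlinarith
      exact h1.trans h2
    · intro h1 h2 x hx
      exact D.supp 0 h1 h2 x (by simpa [pr] using hx)
    · intro h1 h2 x hx
      exact D.supp 1 h1 h2 x (by simpa [pr] using hx)
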